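/- arXiv:2401.13994 — 8 statements merged into one kernel-verified Lean document; each statement's English description precedes it below -/
import Mathlib

section
/- Let p be an odd prime, n ≥ m ≥ 1 integers, and let A = C_{p^n} × C_{p^m} be the direct product of cyclic groups of orders p^n and p^m. For each r with m < r ≤ n, the number of Galois conjugacy classes of characters of A having cardinality φ(p^r) is exactly Σ_{k=0}^{m} φ(p^k) = p^m. -/
theorem exists_aut {d k : ℕ} (hd : 0 < d) {ζ : ℂ} (hζ : IsPrimitiveRoot ζ d) (hk : k.Coprime d) :
    ∃ σ : ℂ ≃+* ℂ, σ ζ = ζ ^ k := by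
  have hint : IsIntegral ℚ ζ := (hζ.isIntegral hd).tower_top
  let z : algebraicClosure ℚ ℂ := ⟨ζ, (mem_algebraicClosure_iff).2 hint.isAlgebraic⟩
  have hz : IsPrimitiveRoot z d := by
    have : IsPrimitiveRoot (algebraMap (algebraicClosure ℚ ℂ) ℂ z) d := hζ
    exact this.of_map_of_injective (algebraMap (algebraicClosure ℚ ℂ) ℂ).injective
  have hzi : IsIntegral ℤ z := hz.isIntegral hd
  have hm : minpoly ℚ z = minpoly ℚ (z ^ k) := by
    rw [minpoly.isIntegrallyClosed_eq_field_fractions' ℚ hzi,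
      minpoly.isIntegrallyClosed_eq_field_fractions' ℚ (hzi.pow k), hz.minpoly_eq_pow_coprime hk]
  have : IsAlgClosure ℚ (algebraicClosure ℚ ℂ) := algebraicClosure.isAlgClosure ℚ ℂ
  have : Normal ℚ (algebraicClosure ℚ ℂ) := inferInstance
  obtain ⟨τ, hτ⟩ := minpoly.exists_algEquiv_of_root' (K := ℚ) (L := algebraicClosure ℚ ℂ)
    (x := z ^ k) (y := z)
    (hzi.tower_top.isAlgebraic) (by rw [hm]; exact minpoly.aeval _ _)
  obtain ⟨s, hs⟩ := exists_isTranscendenceBasis (algebraicClosure ℚ ℂ) ℂ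
  let _ := IsAlgClosed.isAlgClosure_of_transcendence_basis _ hs
  let e := (hs.1.aevalEquiv.symm.toRingEquiv.trans
    (MvPolynomial.mapEquiv _ τ.toRingEquiv)).trans hs.1.aevalEquiv.toRingEquiv
  refine ⟨IsAlgClosure.equivOfEquiv ℂ ℂ e, ?_⟩
  have h1 := IsAlgClosure.equivOfEquiv_algebraMap ℂ ℂ e (algebraMap (algebraicClosure ℚ ℂ) _ z)
  have h2 : e (algebraMap (algebraicClosure ℚ ℂ) _ z) = algebraMap (algebraicClosure ℚ ℂ) _ (z ^ k) := by
    rw [← hτ]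
    change hs.1.aevalEquiv (MvPolynomial.mapEquiv _ τ.toRingEquiv (hs.1.aevalEquiv.symm _)) = _
    rw [AlgEquiv.commutes, MvPolynomial.algebraMap_eq, MvPolynomial.mapEquiv_apply,
      MvPolynomial.map_C, ← MvPolynomial.algebraMap_eq, AlgEquiv.commutes]
    rfl
  rw [h2] at h1
  exact h1

theorem zpow_iff {G : Type*} [Group G] [Finite G] (x y : G) :
    Subgroup.zpowers y = Subgroup.zpowers x ↔ ∃ k : ℕ, k.Coprime (orderOf x) ∧ y = x ^ k := by
  constructor
  · intro h
    have hy : y ∈ Subgroup.zpowers x := h ▸ Subgroup.mem_zpowers y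
    obtain ⟨k, rfl⟩ := (mem_powers_iff_mem_zpowers).2 hy
    refine ⟨k, ?_, rfl⟩
    have h1 : orderOf (x ^ k) = orderOf x := by
      rw [← Nat.card_zpowers, ← Nat.card_zpowers, ← h]
    rw [orderOf_pow, Nat.div_eq_self] at h1
    rcases h1 with h1 | h1
    · exact absurd h1 (orderOf_pos x).ne'
    · exact Nat.Coprime.symm h1
  · rintro ⟨k, hk, rfl⟩
    apply Subgroup.eq_of_le_of_card_ge
    · rw [Subgroup.zpowers_le]
      exact Subgroup.npow_mem_zpowers x k
    · rw [Nat.card_zpowers, Nat.card_zpowers, Nat.Coprime.orderOf_pow hk.symm]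

theorem fiber_card {G : Type*} [Group G] [Finite G] (x : G) :
    {y | Subgroup.zpowers y = Subgroup.zpowers x}.ncard = (orderOf x).totient := by
  classical
  have := Fintype.ofFinite (Subgroup.zpowers x)
  have h : {y | Subgroup.zpowers y = Subgroup.zpowers x}
      = Subtype.val '' {y : Subgroup.zpowers x | orderOf y = orderOf x} := by
    ext y
    simp only [Set.mem_ofPred_eq, Set.mem_image, Subtype.exists, Subgroup.orderOf_mk, exists_and_right,
      exists_eq_right, exists_prop]
    constructor
    · intro h
      refine ⟨h ▸ Subgroup.mem_zpowers y, ?_⟩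
      rw [← Nat.card_zpowers, ← Nat.card_zpowers, ← h]
    · rintro ⟨h1, h2⟩
      apply Subgroup.eq_of_le_of_card_ge
      · rwa [Subgroup.zpowers_le]
      · rw [Nat.card_zpowers, Nat.card_zpowers, h2]
  rw [h, Set.ncard_image_of_injective _ Subtype.val_injective,
    ← IsCyclic.card_orderOf_eq_totient (α := Subgroup.zpowers x), ← Set.ncard_coe_finset]
  · simp
  · rw [← Nat.card_eq_fintype_card, Nat.card_zpowers]

theorem class_eq {A : Type*} [Group A] [Finite (A →* ℂˣ)] (χ : A →* ℂˣ) :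
    {χ' : A →* ℂˣ | ∃ σ : ℂ ≃+* ℂ, ∀ g, (χ' g : ℂ) = σ (χ g)}
      = {χ' | Subgroup.zpowers χ' = Subgroup.zpowers χ} := by
  ext χ'
  simp only [Set.mem_ofPred_eq, zpow_iff]
  have hd := orderOf_pos χ
  set d := orderOf χ with hdd
  have : NeZero d := ⟨hd.ne'⟩
  have hζ := Complex.isPrimitiveRoot_exp d hd.ne'
  set ζ := Complex.exp (2 * Real.pi * Complex.I / d)
  have hv : ∀ g, ∃ i : ℕ, (χ g : ℂ) = ζ ^ i := by
    intro g
    have h1 : (χ g : ℂ) ^ d = 1 := by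
      have := DFunLike.congr_fun (pow_orderOf_eq_one χ) g
      have := congrArg (Units.val) this
      rw [MonoidHom.pow_apply, Units.val_pow_eq_pow_val] at this
      exact this
    obtain ⟨i, _, hi⟩ := hζ.eq_pow_of_pow_eq_one h1
    exact ⟨i, hi.symm⟩
  have key : ∀ (σ : ℂ ≃+* ℂ) (k : ℕ), σ ζ = ζ ^ k → ∀ g, σ (χ g) = ((χ ^ k) g : ℂˣ) := by
    intro σ k h g
    obtain ⟨i, hi⟩ := hv g
    rw [MonoidHom.pow_apply, Units.val_pow_eq_pow_val, hi, map_pow, h, ← pow_mul, ← pow_mul,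
      mul_comm]
  constructor
  · rintro ⟨σ, hσ⟩
    have h1 : IsPrimitiveRoot (σ ζ) d := hζ.map_of_injective σ.injective
    obtain ⟨k, _, hk, hk2⟩ := hζ.isPrimitiveRoot_iff.1 h1
    refine ⟨k, hk, ?_⟩
    ext g
    rw [hσ, key σ k hk2.symm]
  · rintro ⟨k, hk, rfl⟩
    obtain ⟨σ, hσ⟩ := exists_aut hd hζ hk
    exact ⟨σ, fun g => (key σ k hσ g).symm⟩

theorem count_order {p n m r : ℕ} (hp : p.Prime) (hmr : m < r) (hrn : r ≤ n) :
    {a : Multiplicative (ZMod (p ^ n)) × Multiplicative (ZMod (p ^ m)) | orderOf a = p ^ r}.ncard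
      = (p ^ r).totient * p ^ m := by
  have : NeZero (p ^ n) := ⟨(pow_pos hp.pos n).ne'⟩
  have : NeZero (p ^ m) := ⟨(pow_pos hp.pos m).ne'⟩
  have h : {a : Multiplicative (ZMod (p ^ n)) × Multiplicative (ZMod (p ^ m)) | orderOf a = p ^ r}
      = {a : Multiplicative (ZMod (p ^ n)) | orderOf a = p ^ r} ×ˢ Set.univ := by
    ext ⟨a, b⟩
    simp only [Set.mem_ofPred_eq, Set.mem_prod, Set.mem_univ, and_true, Prod.orderOf_mk]
    have ha : orderOf a ∣ p ^ n := by simpa using orderOf_dvd_card (x := a)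
    have hb : orderOf b ∣ p ^ m := by simpa using orderOf_dvd_card (x := b)
    obtain ⟨i, hi, ha⟩ := (Nat.dvd_prime_pow hp).1 ha
    obtain ⟨j, hj, hb⟩ := (Nat.dvd_prime_pow hp).1 hb
    rw [ha, hb]
    rcases le_total i j with hij | hij
    · rw [Nat.lcm_eq_right (pow_dvd_pow p hij)]
      rw [Nat.pow_right_inj hp.two_le, Nat.pow_right_inj hp.two_le]
      omega
    · rw [Nat.lcm_eq_left (pow_dvd_pow p hij)]
  rw [h, Set.ncard_prod, Set.ncard_univ, ← IsCyclic.card_orderOf_eq_totient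
    (α := Multiplicative (ZMod (p ^ n))), ← Set.ncard_coe_finset]
  · simp
  · simpa using pow_dvd_pow p hrn

theorem totient_inj {p s r : ℕ} (hp : p.Prime) (hodd : Odd p)
    (h : (p ^ s).totient = (p ^ r).totient) : s = r := by
  have h3 : 3 ≤ p := by
    have := hp.two_le
    rcases hodd with ⟨k, rfl⟩; omega
  have mono : StrictMono fun s => (p ^ s).totient := by
    apply strictMono_nat_of_lt_succ
    intro s
    rcases s with _ | s
    · simp [Nat.totient_prime hp]; omega
    · simp only [Nat.totient_prime_pow_succ hp]
      have : 0 < p - 1 := by omega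
      gcongr <;> omega
  exact mono.injective h

theorem count_classes {A : Type*} [CommGroup A] [Finite A] (E : (A →* ℂˣ) ≃* A) {p r c : ℕ}
    (hp : p.Prime) (hodd : Odd p) (hpw : ∀ a : A, ∃ s, orderOf a = p ^ s)
    (hc : {a : A | orderOf a = p ^ r}.ncard = (p ^ r).totient * c) :
    Nat.card {C : Set (A →* ℂˣ) | (∃ χ : A →* ℂˣ,
      C = {χ' | ∃ σ : ℂ ≃+* ℂ, ∀ g, (χ' g : ℂ) = σ (χ g)}) ∧ C.ncard = Nat.totient (p ^ r)}
      = c := by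
  classical
  have : Finite (A →* ℂˣ) := Finite.of_equiv A E.symm.toEquiv
  have := Fintype.ofFinite (A →* ℂˣ)
  have hE : ∀ χ, orderOf (E χ) = orderOf χ :=
    fun χ => orderOf_injective (MonoidHom.mk' E (fun a b => E.map_mul' a b)) E.injective χ
  let f : (A →* ℂˣ) → Set (A →* ℂˣ) := fun χ => {χ' | Subgroup.zpowers χ' = Subgroup.zpowers χ}
  have hf : ∀ χ χ', f χ' = f χ ↔ Subgroup.zpowers χ' = Subgroup.zpowers χ := by
    intro χ χ'
    constructor
    · intro h
      have : χ' ∈ f χ' := rfl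
      rw [h] at this
      exact this
    · intro h
      simp only [f, h]
  let S : Finset (A →* ℂˣ) := {χ | orderOf χ = p ^ r}
  have hord : ∀ χ, (f χ).ncard = (p ^ r).totient ↔ orderOf χ = p ^ r := by
    intro χ
    rw [show (f χ).ncard = (orderOf χ).totient from fiber_card χ]
    obtain ⟨s, hs⟩ := hpw (E χ)
    rw [hE] at hs
    constructor
    · intro h
      rw [hs] at h ⊢
      rw [totient_inj hp hodd h]
    · intro h; rw [h]
  have hset : {C : Set (A →* ℂˣ) | (∃ χ : A →* ℂˣ,
      C = {χ' | ∃ σ : ℂ ≃+* ℂ, ∀ g, (χ' g : ℂ) = σ (χ g)}) ∧ C.ncard = Nat.totient (p ^ r)}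
      = ((S.image f : Finset _) : Set (Set (A →* ℂˣ))) := by
    ext C
    simp only [class_eq, Set.mem_ofPred_eq, Finset.coe_image, Set.mem_image, Finset.mem_coe]
    constructor
    · rintro ⟨⟨χ, rfl⟩, h⟩
      exact ⟨χ, by simpa [S] using (hord χ).1 h, rfl⟩
    · rintro ⟨χ, h, rfl⟩
      exact ⟨⟨χ, rfl⟩, (hord χ).2 (by simpa [S] using h)⟩
  rw [hset, Nat.card_coe_set_eq, Set.ncard_coe_finset]
  have hS : S.card = (p ^ r).totient * c := by
    rw [← hc, ← Set.ncard_coe_finset, ← Set.ncard_image_of_injective _ E.injective]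
    congr 1
    ext a
    simp only [Set.mem_image, Finset.mem_coe, Set.mem_ofPred_eq, S, Finset.mem_filter,
      Finset.mem_univ, true_and]
    constructor
    · rintro ⟨χ, h, rfl⟩
      rw [hE, h]
    · intro h
      exact ⟨E.symm a, by rw [← hE, MulEquiv.apply_symm_apply, h], by simp⟩
  have hfib : ∀ b ∈ S.image f, ({a ∈ S | f a = b}).card = (p ^ r).totient := by
    intro b hb
    obtain ⟨χ, hχ, rfl⟩ := Finset.mem_image.1 hb
    have hχ' : orderOf χ = p ^ r := by simpa [S] using hχ
    rw [← (hord χ).2 hχ', ← Set.ncard_coe_finset]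
    congr 1
    ext a
    simp only [Finset.mem_coe, Finset.mem_filter, hf, S, Finset.mem_univ, true_and]
    change _ ↔ Subgroup.zpowers a = Subgroup.zpowers χ
    constructor
    · exact fun h => h.2
    · intro h
      refine ⟨?_, h⟩
      rw [← Nat.card_zpowers, h, Nat.card_zpowers, hχ']
  have h1 := Finset.card_eq_sum_card_image f S
  rw [Finset.sum_congr rfl hfib, Finset.sum_const, smul_eq_mul, hS, mul_comm] at h1
  have hpos : 0 < (p ^ r).totient := Nat.totient_pos.2 (pow_pos hp.pos r)
  exact (Nat.eq_of_mul_eq_mul_right hpos h1).symm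

theorem stmt_5 (p n m : ℕ) (hp : p.Prime) (hodd : Odd p) (hm : 1 ≤ m) (hnm : m ≤ n) :
    ∀ r : ℕ, m < r → r ≤ n →
      (Nat.card {C : Set ((Multiplicative (ZMod (p ^ n)) × Multiplicative (ZMod (p ^ m))) →* ℂˣ) |
          (∃ χ : (Multiplicative (ZMod (p ^ n)) × Multiplicative (ZMod (p ^ m))) →* ℂˣ,
              C = {χ' | ∃ σ : ℂ ≃+* ℂ, ∀ g, (χ' g : ℂ) = σ (χ g)}) ∧
            C.ncard = Nat.totient (p ^ r)}
        = ∑ k ∈ Finset.range (m + 1), Nat.totient (p ^ k)) ∧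
      (∑ k ∈ Finset.range (m + 1), Nat.totient (p ^ k)) = p ^ m := by
  intro r hmr hrn
  have hsum : (∑ k ∈ Finset.range (m + 1), Nat.totient (p ^ k)) = p ^ m := by
    rw [← Nat.sum_divisors_prime_pow (f := Nat.totient) hp, Nat.sum_totient]
  refine ⟨?_, hsum⟩
  rw [hsum]
  classical
  have : NeZero (p ^ n) := ⟨(pow_pos hp.pos n).ne'⟩
  have : NeZero (p ^ m) := ⟨(pow_pos hp.pos m).ne'⟩
  obtain ⟨E⟩ := CommGroup.monoidHom_mulEquiv_of_hasEnoughRootsOfUnity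
    (Multiplicative (ZMod (p ^ n)) × Multiplicative (ZMod (p ^ m))) ℂ
  have hc := count_order hp hmr hrn
  have hpw : ∀ a : Multiplicative (ZMod (p ^ n)) × Multiplicative (ZMod (p ^ m)),
      ∃ s, orderOf a = p ^ s := by
    intro a
    have ha : orderOf a ∣ p ^ (n + m) := by simpa [pow_add] using orderOf_dvd_card (x := a)
    obtain ⟨i, hi, ha⟩ := (Nat.dvd_prime_pow hp).1 ha
    exact ⟨i, ha⟩
  exact count_classes E hp hodd hpw hc
end

section
/- Let p be an odd prime, n ≥ m ≥ 1 integers, and let A = C_{p^n} × C_{p^m} be the direct product of cyclic groups of orders p^n and p^m. Then the total number of Galois conjugacy classes of characters of A equals Σ_{k=0}^{m} (n + m + 1 − 2k)·φ(p^k). -/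
open Cardinal in
theorem aux_ext {R K L : Type} [Field R] [Field K] [Field L] [Algebra R K] [Algebra R L]
    [IsAlgClosed K] [IsAlgClosed L] (hR : #R ≤ ℵ₀) (hK : ℵ₀ < #K) (hKL : #K = #L) :
    ∃ σ : K ≃+* L, ∀ r : R, σ (algebraMap R K r) = algebraMap R L r := by
  obtain ⟨s, hs⟩ := exists_isTranscendenceBasis R K
  obtain ⟨t, ht⟩ := exists_isTranscendenceBasis R L
  have h1 := IsAlgClosed.cardinal_eq_cardinal_transcendence_basis_of_aleph0_lt' _ hs hR hK
  have h2 := IsAlgClosed.cardinal_eq_cardinal_transcendence_basis_of_aleph0_lt' _ ht hR (hKL ▸ hK)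
  obtain ⟨e⟩ := Cardinal.eq.1 (h1.symm.trans (hKL.trans h2))
  let := IsAlgClosed.isAlgClosure_of_transcendence_basis _ hs
  let := IsAlgClosed.isAlgClosure_of_transcendence_basis _ ht
  let E : Algebra.adjoin R (Set.range ((↑) : s → K)) ≃ₐ[R] Algebra.adjoin R (Set.range ((↑) : t → L)) :=
    hs.1.aevalEquiv.symm.trans ((MvPolynomial.renameEquiv R e).trans ht.1.aevalEquiv)
  refine ⟨IsAlgClosure.equivOfEquiv K L E.toRingEquiv, fun r => ?_⟩
  have := IsAlgClosure.equivOfEquiv_algebraMap K L E.toRingEquiv (algebraMap R _ r)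
  rw [← IsScalarTower.algebraMap_apply] at this
  rw [this]
  have h3 : E.toRingEquiv (algebraMap R _ r) = algebraMap R _ r := E.commutes r
  rw [h3, ← IsScalarTower.algebraMap_apply]

theorem aux_gal {a b : ℂ} (ha : IsIntegral ℚ a) (hab : minpoly ℚ a = minpoly ℚ b) :
    ∃ σ : ℂ ≃+* ℂ, σ a = b := by
  have : Fact (Irreducible (minpoly ℚ a)) := ⟨minpoly.irreducible ha⟩
  let i : AdjoinRoot (minpoly ℚ a) →+* ℂ := AdjoinRoot.lift (algebraMap ℚ ℂ) a (minpoly.aeval ℚ a)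
  let j : AdjoinRoot (minpoly ℚ a) →+* ℂ := AdjoinRoot.lift (algebraMap ℚ ℂ) b
    (by rw [hab]; exact minpoly.aeval ℚ b)
  have hc : Cardinal.mk (AdjoinRoot (minpoly ℚ a)) ≤ Cardinal.aleph0 := by
    have := Cardinal.mk_le_of_surjective (AdjoinRoot.mk_surjective (g := minpoly ℚ a))
    refine this.trans ?_
    exact Polynomial.cardinalMk_le_max.trans (by simp)
  obtain ⟨σ, h⟩ := @aux_ext (AdjoinRoot (minpoly ℚ a)) ℂ ℂ _ _ _ i.toAlgebra j.toAlgebra _ _ hc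
    (by rw [Cardinal.mk_complex]; exact Cardinal.aleph0_lt_continuum) rfl
  refine ⟨σ, ?_⟩
  have := h (AdjoinRoot.root _)
  have e1 : i (AdjoinRoot.root _) = a := AdjoinRoot.lift_root _
  have e2 : j (AdjoinRoot.root _) = b := AdjoinRoot.lift_root _
  change σ (i _) = j _ at this
  rwa [e1, e2] at this

theorem aux_iff {A : Type*} [CommGroup A] [Finite A] (χ χ' : A →* ℂˣ) (hfin : ∀ ψ : A →* ℂˣ, IsOfFinOrder ψ) :
    (∃ σ : ℂ ≃+* ℂ, ∀ g, (χ' g : ℂ) = σ (χ g)) ↔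
      Subgroup.zpowers χ' = Subgroup.zpowers χ := by
  have key : ∀ (χ χ' : A →* ℂˣ) (σ : ℂ ≃+* ℂ), (∀ g, (χ' g : ℂ) = σ (χ g)) →
      Subgroup.zpowers χ' ≤ Subgroup.zpowers χ := by
    intro χ χ' σ h
    have hd : orderOf χ ≠ 0 := (hfin χ).orderOf_pos.ne'
    have : NeZero (orderOf χ) := ⟨hd⟩
    have hz := Complex.isPrimitiveRoot_exp (orderOf χ) hd
    obtain ⟨k, -, hk⟩ := hz.eq_pow_of_pow_eq_one
      (ξ := σ (Complex.exp (2 * Real.pi * Complex.I / (orderOf χ : ℕ)))) (by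
        rw [← map_pow, hz.pow_eq_one, map_one])
    rw [Subgroup.zpowers_le]
    refine ⟨(k : ℤ), ?_⟩
    ext g
    have hg : (χ g : ℂ) ^ orderOf χ = 1 := by
      have := DFunLike.congr_fun (pow_orderOf_eq_one χ) g
      rw [MonoidHom.pow_apply, MonoidHom.one_apply] at this
      rw [← Units.val_pow_eq_pow_val, this, Units.val_one]
    obtain ⟨i, -, hi⟩ := hz.eq_pow_of_pow_eq_one hg
    rw [h g, ← hi, map_pow, ← hk, ← pow_mul, mul_comm k i, pow_mul, hi]
    simp
  constructor
  · rintro ⟨σ, h⟩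
    exact le_antisymm (key _ _ σ h) (key _ _ σ.symm fun g => by rw [h]; simp)
  · intro h
    have hd : orderOf χ ≠ 0 := (hfin χ).orderOf_pos.ne'
    have : NeZero (orderOf χ) := ⟨hd⟩
    have hz := Complex.isPrimitiveRoot_exp (orderOf χ) hd
    have hm : χ' ∈ Submonoid.powers χ := by
      rw [(hfin χ).mem_powers_iff_mem_zpowers, ← h]; exact Subgroup.mem_zpowers _
    obtain ⟨k, rfl⟩ := hm
    have ho : orderOf (χ ^ k) = orderOf χ := by
      rw [← Nat.card_zpowers, ← Nat.card_zpowers]; simp only at h; rw [h]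
    have hcop : Nat.Coprime k (orderOf χ) := by
      rw [(hfin χ).orderOf_pow] at ho
      have h1 := Nat.div_mul_cancel (Nat.gcd_dvd_left (orderOf χ) k)
      rw [ho] at h1
      rw [Nat.coprime_comm]
      exact Nat.eq_of_mul_eq_mul_left (Nat.pos_of_ne_zero hd) (by simpa using h1)
    obtain ⟨σ, hσ⟩ := aux_gal (a := Complex.exp (2 * Real.pi * Complex.I / (orderOf χ : ℕ)))
      (b := Complex.exp (2 * Real.pi * Complex.I / (orderOf χ : ℕ)) ^ k)
      (hz.isIntegral (Nat.pos_of_ne_zero hd)).tower_top (by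
        rw [← Polynomial.cyclotomic_eq_minpoly_rat hz (Nat.pos_of_ne_zero hd),
          ← Polynomial.cyclotomic_eq_minpoly_rat (hz.pow_of_coprime k hcop) (Nat.pos_of_ne_zero hd)])
    refine ⟨σ, fun g => ?_⟩
    have hg : (χ g : ℂ) ^ orderOf χ = 1 := by
      have := DFunLike.congr_fun (pow_orderOf_eq_one χ) g
      rw [MonoidHom.pow_apply, MonoidHom.one_apply] at this
      rw [← Units.val_pow_eq_pow_val, this, Units.val_one]
    obtain ⟨i, -, hi⟩ := hz.eq_pow_of_pow_eq_one hg
    rw [← hi, map_pow, hσ, ← pow_mul, mul_comm k i, pow_mul, hi]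
    simp

theorem aux_fiber {X : Type*} [Group X] [Fintype X] [DecidableEq (Subgroup X)] (x : X) :
    (Finset.univ.filter fun y : X => Subgroup.zpowers y = Subgroup.zpowers x).card
      = Nat.totient (orderOf x) := by
  classical
  have h := IsCyclic.card_orderOf_eq_totient (α := Subgroup.zpowers x) (d := orderOf x)
    (by rw [Fintype.card_zpowers])
  rw [← h]
  symm
  refine Finset.card_bij (fun a _ => (a : X)) ?_ ?_ ?_
  · intro a ha
    simp only [Finset.mem_filter, Finset.mem_univ, true_and] at ha ⊢
    refine Subgroup.eq_of_le_of_card_ge (Subgroup.zpowers_le.2 a.2) ?_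
    rw [Nat.card_zpowers, Nat.card_zpowers, Subgroup.orderOf_coe, ha]
  · intro a _ b _ hab
    exact Subtype.ext hab
  · intro b hb
    simp only [Finset.mem_filter, Finset.mem_univ, true_and] at hb
    refine ⟨⟨b, hb ▸ Subgroup.mem_zpowers b⟩, ?_, rfl⟩
    simp only [Finset.mem_filter, Finset.mem_univ, true_and, Subgroup.orderOf_mk]
    rw [← Nat.card_zpowers, ← Nat.card_zpowers, hb]

theorem aux_count {X S : Type*} [Group X] [Fintype X] (F : X → S)
    (hF : ∀ x y, F x = F y ↔ Subgroup.zpowers x = Subgroup.zpowers y) :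
    (Nat.card (Set.range F) : ℚ) = ∑ x : X, (1 : ℚ) / Nat.totient (orderOf x) := by
  classical
  rw [← Finset.sum_fiberwise_of_maps_to (s := Finset.univ) (t := Finset.univ.image F) (g := F)
    (by simp)]
  have : ∀ c ∈ Finset.univ.image F, ∑ x ∈ Finset.univ.filter (fun x => F x = c),
      (1 : ℚ) / Nat.totient (orderOf x) = 1 := by
    intro c hc
    obtain ⟨x, -, rfl⟩ := Finset.mem_image.1 hc
    have h1 : ∀ y ∈ Finset.univ.filter (fun y => F y = F x),
        (1 : ℚ) / Nat.totient (orderOf y) = 1 / Nat.totient (orderOf x) := by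
      intro y hy
      have := (hF _ _).1 (Finset.mem_filter.1 hy).2
      rw [← Nat.card_zpowers, this, Nat.card_zpowers]
    rw [Finset.sum_congr rfl h1, Finset.sum_const]
    simp only [hF]
    have h2 := aux_fiber x
    rw [show (Finset.univ.filter fun y : X => Subgroup.zpowers y = Subgroup.zpowers x).card
      = Nat.totient (orderOf x) by convert h2, nsmul_eq_mul, mul_one_div_cancel]
    exact_mod_cast (Nat.totient_pos.2 (orderOf_pos x)).ne'
  rw [Finset.sum_congr rfl this, Nat.card_eq_card_toFinset, Set.toFinset_range]
  simp

theorem aux_cyc (p n : ℕ) (hp : p.Prime) [NeZero (p ^ n)] (f : ℕ → ℚ) :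
    ∑ a : Multiplicative (ZMod (p ^ n)), f (orderOf a)
      = ∑ i ∈ Finset.range (n + 1), (Nat.totient (p ^ i) : ℚ) * f (p ^ i) := by
  classical
  have hc : Fintype.card (Multiplicative (ZMod (p ^ n))) = p ^ n := by
    rw [Fintype.card_multiplicative, ZMod.card]
  rw [← Finset.sum_fiberwise_of_maps_to (s := Finset.univ) (t := (p ^ n).divisors)
    (g := fun a => orderOf a) (by
      intro a _
      rw [Nat.mem_divisors]
      exact ⟨(orderOf_dvd_card (x := a)).trans hc.dvd, NeZero.ne _⟩), Nat.sum_divisors_prime_pow hp]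
  refine Finset.sum_congr rfl fun i hi => ?_
  have h1 : ∀ y ∈ Finset.univ.filter
      (fun y : Multiplicative (ZMod (p ^ n)) => orderOf y = p ^ i), f (orderOf y) = f (p ^ i) := by
    intro y hy
    rw [(Finset.mem_filter.1 hy).2]
  rw [Finset.sum_congr rfl h1, Finset.sum_const, IsCyclic.card_orderOf_eq_totient, nsmul_eq_mul]
  rw [hc]
  exact pow_dvd_pow _ (by simpa [Nat.lt_succ_iff] using hi)

theorem aux_row (f : ℕ → ℕ) (m n : ℕ) (h : m ≤ n) :
    ∑ i ∈ Finset.range (n + 1), f (min i m) = ∑ i ∈ Finset.range m, f i + (n + 1 - m) * f m := by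
  induction n, h using Nat.le_induction with
  | base =>
    rw [Finset.sum_range_succ]
    simp only [min_self, Nat.add_sub_cancel_left, one_mul]
    congr 1
    exact Finset.sum_congr rfl fun i hi => by rw [min_eq_left (Finset.mem_range.1 hi).le]
  | succ n hn ih =>
    rw [Finset.sum_range_succ, ih, min_eq_right (by omega), show n + 1 + 1 - m = (n + 1 - m) + 1 by omega]
    ring

theorem aux_comb (f : ℕ → ℕ) (m n : ℕ) (h : m ≤ n) :
    ∑ j ∈ Finset.range (m + 1), ∑ i ∈ Finset.range (n + 1), f (min i j)
      = ∑ k ∈ Finset.range (m + 1), (n + m + 1 - 2 * k) * f k := by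
  induction m with
  | zero => simp
  | succ m ih =>
    rw [Finset.sum_range_succ, ih (by omega), aux_row f _ _ h, Finset.sum_range_succ _ (m + 1),
      ← add_assoc, ← Finset.sum_add_distrib]
    congr 1
    · refine Finset.sum_congr rfl fun k hk => ?_
      have := Finset.mem_range.1 hk
      rw [show n + (m + 1) + 1 - 2 * k = (n + m + 1 - 2 * k) + 1 by omega]
      ring
    · congr 1
      omega

theorem stmt_7 (p n m : ℕ) (hp : p.Prime) (hodd : Odd p) (hm : 1 ≤ m) (hnm : m ≤ n) :
    Nat.card {C : Set ((Multiplicative (ZMod (p ^ n)) × Multiplicative (ZMod (p ^ m))) →* ℂˣ) |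
        ∃ χ : (Multiplicative (ZMod (p ^ n)) × Multiplicative (ZMod (p ^ m))) →* ℂˣ,
          C = {χ' | ∃ σ : ℂ ≃+* ℂ, ∀ g, (χ' g : ℂ) = σ (χ g)}}
      = ∑ k ∈ Finset.range (m + 1), (n + m + 1 - 2 * k) * Nat.totient (p ^ k) := by
  have : NeZero (p ^ n) := ⟨(pow_pos hp.pos n).ne'⟩
  have : NeZero (p ^ m) := ⟨(pow_pos hp.pos m).ne'⟩
  obtain ⟨e⟩ := CommGroup.monoidHom_mulEquiv_of_hasEnoughRootsOfUnity
    (Multiplicative (ZMod (p ^ n)) × Multiplicative (ZMod (p ^ m))) ℂ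
  have : Fintype ((Multiplicative (ZMod (p ^ n)) × Multiplicative (ZMod (p ^ m))) →* ℂˣ) :=
    Fintype.ofEquiv _ e.symm.toEquiv
  let F : ((Multiplicative (ZMod (p ^ n)) × Multiplicative (ZMod (p ^ m))) →* ℂˣ) →
      Set ((Multiplicative (ZMod (p ^ n)) × Multiplicative (ZMod (p ^ m))) →* ℂˣ) :=
    fun χ => {χ' | Subgroup.zpowers χ' = Subgroup.zpowers χ}
  have hset : {C : Set ((Multiplicative (ZMod (p ^ n)) × Multiplicative (ZMod (p ^ m))) →* ℂˣ) |
        ∃ χ : (Multiplicative (ZMod (p ^ n)) × Multiplicative (ZMod (p ^ m))) →* ℂˣ,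
          C = {χ' | ∃ σ : ℂ ≃+* ℂ, ∀ g, (χ' g : ℂ) = σ (χ g)}} = Set.range F := by
    ext C
    have hχ : ∀ χ, {χ' : (Multiplicative (ZMod (p ^ n)) × Multiplicative (ZMod (p ^ m))) →* ℂˣ |
        ∃ σ : ℂ ≃+* ℂ, ∀ g, (χ' g : ℂ) = σ (χ g)} = F χ := fun χ =>
      Set.ext fun χ' => aux_iff χ χ' (fun ψ => isOfFinOrder_of_finite ψ)
    constructor
    · rintro ⟨χ, rfl⟩
      exact ⟨χ, (hχ χ).symm⟩
    · rintro ⟨χ, rfl⟩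
      exact ⟨χ, (hχ χ).symm⟩
  rw [hset]
  have hF : ∀ x y, F x = F y ↔ Subgroup.zpowers x = Subgroup.zpowers y := by
    intro x y
    constructor
    · intro h
      have : x ∈ F y := h ▸ (rfl : Subgroup.zpowers x = Subgroup.zpowers x)
      exact this
    · intro h
      simp only [F, h]
  have hcnt := aux_count F hF
  have hsum : ∑ x : (Multiplicative (ZMod (p ^ n)) × Multiplicative (ZMod (p ^ m))) →* ℂˣ,
      (1 : ℚ) / Nat.totient (orderOf x)
      = ∑ a : Multiplicative (ZMod (p ^ n)) × Multiplicative (ZMod (p ^ m)),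
        (1 : ℚ) / Nat.totient (orderOf a) :=
    Fintype.sum_equiv e.toEquiv _ _ fun x => by
      rw [show e.toEquiv x = e x from rfl, MulEquiv.orderOf_eq]
  rw [hsum, Fintype.sum_prod_type_right] at hcnt
  simp only [Prod.orderOf_mk] at hcnt
  rw [Finset.sum_congr rfl (fun b _ => aux_cyc p n hp
      (fun d => (1 : ℚ) / Nat.totient (Nat.lcm d (orderOf b)))),
    aux_cyc p m hp (fun d => ∑ i ∈ Finset.range (n + 1), (Nat.totient (p ^ i) : ℚ) *
      ((1 : ℚ) / Nat.totient (Nat.lcm (p ^ i) d)))] at hcnt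
  rw [← aux_comb (fun k => Nat.totient (p ^ k)) m n hnm]
  have : (Nat.card (Set.range F) : ℚ) = ((∑ j ∈ Finset.range (m + 1),
      ∑ i ∈ Finset.range (n + 1), Nat.totient (p ^ (min i j)) : ℕ) : ℚ) := by
    rw [hcnt]
    push_cast
    refine Finset.sum_congr rfl fun j _ => ?_
    rw [Finset.mul_sum]
    refine Finset.sum_congr rfl fun i _ => ?_
    have hpos : ∀ i, (Nat.totient (p ^ i) : ℚ) ≠ 0 := fun i => by
      exact_mod_cast (Nat.totient_pos.2 (pow_pos hp.pos i)).ne'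
    rcases le_total i j with h | h
    · rw [Nat.lcm_eq_right (pow_dvd_pow p h), min_eq_left h]
      field_simp [hpos j]
    · rw [Nat.lcm_eq_left (pow_dvd_pow p h), min_eq_right h]
      field_simp [hpos i]
  exact_mod_cast this
end

section
/- Let p be an odd prime, let n, s be integers with 1 ≤ s < n, and let r be an integer coprime to p whose multiplicative order modulo p^n is p^s. Then for each t with 1 ≤ t ≤ s, the action of the cyclic subgroup ⟨r⟩ of the units of ℤ/p^nℤ on ℤ/p^nℤ by multiplication has exactly φ(p^{n−s}) = p^{n−s} − p^{n−s−1} orbits of size p^t. -/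
open MulAction in
theorem aux_count_s12 {G : Type*} [Group G] {X : Type*} [Fintype X] [MulAction G X] (u : G) (p t a b : ℕ)
    (hp : p.Prime)
    (h1 : Nat.card {x : X | u ^ p ^ (t+1) • x = x} = a)
    (h0 : Nat.card {x : X | u ^ p ^ t • x = x} = b) :
    Nat.card {C : Set X | (∃ x : X, C = MulAction.orbit (Subgroup.zpowers u) x) ∧
            C.ncard = p ^ (t+1)} * p ^ (t+1) = a - b := by
  classical
  have key : ∀ (x : X) (k : ℕ), (orbit (Subgroup.zpowers u) x).ncard ∣ k ↔ u ^ k • x = x := by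
    intro x k
    have : Fintype (orbit (Subgroup.zpowers u) x) := Fintype.ofFinite _
    rw [← Nat.card_coe_set_eq, Nat.card_eq_fintype_card, ← minimalPeriod_eq_card,
      ← Function.isPeriodicPt_iff_minimalPeriod_dvd, Function.IsPeriodicPt, Function.IsFixedPt,
      smul_iterate]
  have key2 : ∀ x : X, (orbit (Subgroup.zpowers u) x).ncard = p ^ (t+1) ↔
      (u ^ p ^ (t+1) • x = x ∧ ¬ u ^ p ^ t • x = x) := by
    intro x
    rw [← key, ← key]
    constructor
    · intro h
      rw [h]
      refine ⟨dvd_rfl, fun h => ?_⟩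
      have := (Nat.pow_dvd_pow_iff_le_right hp.one_lt).1 h
      omega
    · rintro ⟨h, h'⟩
      exact Nat.eq_prime_pow_of_dvd_least_prime_pow hp h' h
  set S := {C : Set X | (∃ x : X, C = MulAction.orbit (Subgroup.zpowers u) x) ∧
            C.ncard = p ^ (t+1)} with hS
  have hc := Finset.card_eq_sum_card_fiberwise
    (f := fun x : X => orbit (Subgroup.zpowers u) x)
    (s := Finset.univ.filter fun x : X => (orbit (Subgroup.zpowers u) x).ncard = p ^ (t+1))
    (t := S.toFinset) (by
      intro x hx
      simp only [Finset.coe_filter, Finset.mem_univ, true_and, Set.mem_setOf_eq] at hx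
      simp only [Set.coe_toFinset]
      exact ⟨⟨x, rfl⟩, hx⟩)
  rw [Finset.sum_const_nat (m := p ^ (t+1))] at hc
  · rw [Nat.card_eq_card_toFinset, ← hc]
    simp only [key2]
    rw [← h1, ← h0, Nat.card_eq_card_toFinset, Nat.card_eq_card_toFinset,
      ← Finset.card_sdiff_of_subset]
    · congr 1
      ext x
      simp
    · intro x
      simp only [Set.mem_toFinset, Set.mem_setOf_eq]
      rw [← key, ← key]
      exact fun h => h.trans (pow_dvd_pow _ (Nat.le_succ _))
  · intro C hC
    obtain ⟨⟨x, rfl⟩, hx⟩ := Set.mem_toFinset.1 hC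
    rw [← hx, ← Set.ncard_coe_finset]
    congr 1
    ext y
    simp only [Finset.coe_filter, Finset.mem_filter, Finset.mem_univ, true_and, Set.mem_setOf_eq]
    rw [← orbit_eq_iff]
    constructor
    · exact fun h => h.2
    · intro h
      exact ⟨by rw [h, hx], h⟩

theorem aux_fix (p n s : ℕ) (r : ℤ) (hp : p.Prime) (hodd : Odd p)
    (hs : 1 ≤ s) (hsn : s < n) (hr : Int.gcd r p = 1)
    (u : (ZMod (p ^ n))ˣ) (hu : (u : ZMod (p ^ n)) = (r : ZMod (p ^ n)))
    (hord : orderOf ((r : ZMod (p ^ n))) = p ^ s) (k : ℕ) (hk : k ≤ s) :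
    Nat.card {x : ZMod (p ^ n) | u ^ p ^ k • x = x} = p ^ (n - s + k) := by
  have : Fact p.Prime := ⟨hp⟩
  have hpi : Prime (p : ℤ) := Nat.prime_iff_prime_int.1 hp
  have hrp : ¬ (p : ℤ) ∣ r := by
    intro h
    have := Int.dvd_coe_gcd h dvd_rfl
    rw [hr] at this
    exact hpi.not_unit (isUnit_of_dvd_one (by exact_mod_cast this))
  have hdv : ∀ j : ℕ, ((p ^ n : ℕ) : ℤ) ∣ r ^ j - 1 ↔ p ^ s ∣ j := by
    intro j
    rw [← hord, orderOf_dvd_iff_pow_eq_one, ← ZMod.intCast_zmod_eq_zero_iff_dvd]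
    push_cast
    rw [sub_eq_zero]
  have h1 : (p : ℤ) ∣ r - 1 := by
    have h := (hdv (p ^ s)).2 dvd_rfl
    have h2 : (p : ℤ) ∣ r ^ p ^ s - 1 :=
      dvd_trans (by push_cast; exact dvd_pow_self _ (by omega)) h
    rw [← ZMod.intCast_zmod_eq_zero_iff_dvd] at h2 ⊢
    push_cast at h2 ⊢
    rwa [ZMod.pow_card_pow] at h2
  have hm : ∀ j : ℕ, emultiplicity (p : ℤ) (r ^ p ^ j - 1) = emultiplicity (p : ℤ) (r - 1) + j := by
    intro j
    have := emultiplicity_pow_prime_pow_sub_pow_prime_pow hpi hodd h1 hrp j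
    simpa using this
  have hA : (n : ℕ∞) ≤ emultiplicity (p : ℤ) (r - 1) + s := by
    rw [← hm]
    apply le_emultiplicity_of_pow_dvd
    exact_mod_cast (hdv (p ^ s)).2 dvd_rfl
  have hB : emultiplicity (p : ℤ) (r - 1) + (s - 1 : ℕ) < n := by
    rw [← hm, emultiplicity_lt_iff_not_dvd]
    intro h
    have := (hdv (p ^ (s-1))).1 (by exact_mod_cast h)
    have := (Nat.pow_dvd_pow_iff_le_right hp.one_lt).1 this
    omega
  have he : emultiplicity (p : ℤ) (r - 1) = (n - s : ℕ) := by
    generalize emultiplicity (p : ℤ) (r - 1) = e at hA hB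
    induction e using ENat.recTopCoe with
    | top => simp at hB
    | coe e => norm_cast at hA hB ⊢; omega
  have hmk := hm k
  rw [he, ← Nat.cast_add, emultiplicity_eq_coe] at hmk
  have hg : Nat.gcd (p ^ n) (r ^ p ^ k - 1).natAbs = p ^ (n - s + k) := by
    obtain ⟨l, hl, hl2⟩ := (Nat.dvd_prime_pow hp).1 (Nat.gcd_dvd_left (p ^ n) (r ^ p ^ k - 1).natAbs)
    rw [hl2]
    congr 1
    apply le_antisymm
    · by_contra hlt
      apply hmk.2
      have : p ^ l ∣ (r ^ p ^ k - 1).natAbs := hl2 ▸ Nat.gcd_dvd_right _ _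
      have := (pow_dvd_pow p (show n - s + k + 1 ≤ l by omega)).trans this
      rw [← Int.natCast_dvd] at this
      exact_mod_cast this
    · rw [← Nat.pow_dvd_pow_iff_le_right hp.one_lt, ← hl2]
      apply Nat.dvd_gcd
      · exact pow_dvd_pow _ (by omega)
      · rw [← Int.natCast_dvd]; exact_mod_cast hmk.1
  have hK := IsAddCyclic.card_nsmulAddMonoidHom_ker (G := ZMod (p ^ n)) (r ^ p ^ k - 1).natAbs
  rw [Nat.card_zmod, hg] at hK
  rw [← hK]
  congr 1
  have : {x : ZMod (p ^ n) | u ^ p ^ k • x = x} = ((nsmulAddMonoidHom (r ^ p ^ k - 1).natAbs : ZMod (p ^ n) →+ ZMod (p ^ n)).ker : Set _) := by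
    ext x
    simp only [Set.mem_setOf_eq, SetLike.mem_coe, AddMonoidHom.mem_ker, nsmulAddMonoidHom_apply]
    rw [natAbs_nsmul_eq_zero, zsmul_eq_mul, Units.smul_def]
    push_cast
    rw [hu, sub_mul, one_mul, sub_eq_zero, smul_eq_mul]
  rw [this]
  rfl

/-- **Lemma (orbits of size `p^t`).** Let `p` be an odd prime, `1 ≤ s < n`, and
`r` an integer coprime to `p` whose multiplicative order modulo `p^n` is `p^s`.
For each `1 ≤ t ≤ s`, the multiplication action of the cyclic subgroup `⟨r⟩` of
`(ℤ/p^nℤ)ˣ` on `ℤ/p^nℤ` has exactly `φ(p^(n-s)) = p^(n-s) − p^(n-s-1)` orbits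
of size `p^t`. -/
theorem stmt_12 (p n s : ℕ) (r : ℤ) (hp : p.Prime) (hodd : Odd p)
    (hs : 1 ≤ s) (hsn : s < n) (hr : Int.gcd r p = 1)
    (u : (ZMod (p ^ n))ˣ) (hu : (u : ZMod (p ^ n)) = (r : ZMod (p ^ n)))
    (hord : orderOf ((r : ZMod (p ^ n))) = p ^ s) :
    ∀ t : ℕ, 1 ≤ t → t ≤ s →
      Nat.card {C : Set (ZMod (p ^ n)) |
          (∃ x : ZMod (p ^ n), C = MulAction.orbit (Subgroup.zpowers u) x) ∧
            C.ncard = p ^ t}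
        = Nat.totient (p ^ (n - s)) ∧
      Nat.totient (p ^ (n - s)) = p ^ (n - s) - p ^ (n - s - 1) := by
  have htot : Nat.totient (p ^ (n - s)) = p ^ (n - s) - p ^ (n - s - 1) := by
    rw [Nat.totient_prime_pow hp (by omega)]
    obtain ⟨m, hm⟩ : ∃ m, n - s = m + 1 := ⟨n - s - 1, by omega⟩
    rw [hm, Nat.add_sub_cancel, Nat.mul_sub, mul_one, pow_succ]
  intro t ht hts
  refine ⟨?_, htot⟩
  obtain ⟨t, rfl⟩ : ∃ m, t = m + 1 := ⟨t - 1, by omega⟩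
  have : NeZero (p ^ n) := ⟨pow_ne_zero _ hp.ne_zero⟩
  have h := aux_count_s12 u p t _ _ hp
    (aux_fix p n s r hp hodd hs hsn hr u hu hord (t + 1) hts)
    (aux_fix p n s r hp hodd hs hsn hr u hu hord t (by omega))
  apply Nat.eq_of_mul_eq_mul_right (pow_pos hp.pos (t + 1))
  rw [h, htot, Nat.sub_mul, ← pow_add, ← pow_add]
  congr 2
  omega
end

section
/- Let p be an odd prime and let G be the split metacyclic p-group G = ⟨a, b | a^(p^n) = b^(p^m) = 1, b a b⁻¹ = a^r⟩ with n ≥ 2, m ≥ 1, gcd(r, p^n) = 1 and r of multiplicative order p^s modulo p^n, 1 ≤ s ≤ min{n−1, m}. Then the number of conjugacy classes of G equals p^{n+m−s} + p^{n+m−s−1} − p^{n+m−2s−1}. -/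
lemma aux_base (p n s : ℕ) (r : ℤ) (hp : p.Prime) (hodd : Odd p)
    (hs1 : 1 ≤ s) (hsn : s ≤ n - 1)
    (hr : Int.gcd r (p ^ n) = 1) (hord : orderOf ((r : ZMod (p ^ n))) = p ^ s) :
    (p:ℤ) ∣ r - 1 ∧ ¬ (p:ℤ) ∣ r ∧ emultiplicity (p:ℤ) (r - 1) = (n - s : ℕ) := by
  have := Fact.mk hp
  have key : ∀ k : ℕ, (p:ℤ)^n ∣ r ^ k - 1 ↔ p ^ s ∣ k := by
    intro k
    rw [← hord, orderOf_dvd_iff_pow_eq_one, ← sub_eq_zero]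
    have := ZMod.intCast_zmod_eq_zero_iff_dvd (r ^ k - 1) (p ^ n)
    push_cast at this
    exact this.symm
  have hnr : ¬ (p:ℤ) ∣ r := by
    intro h
    have h1 : (p:ℤ) ∣ (Int.gcd r (p^n) : ℤ) :=
      Int.dvd_coe_gcd h (dvd_pow_self _ (by omega))
    rw [hr] at h1
    have := Int.natCast_dvd_natCast.mp h1
    exact hp.one_lt.ne' (Nat.dvd_one.mp this)
  have hpr : (p:ℤ) ∣ r - 1 := by
    have h1 : (p:ℤ) ∣ r ^ (p^s) - 1 := (dvd_pow_self _ (by omega)).trans ((key (p^s)).2 dvd_rfl)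
    have h2 : ((r ^ (p^s) - 1 : ℤ) : ZMod p) = 0 := (ZMod.intCast_zmod_eq_zero_iff_dvd _ _).2 h1
    push_cast at h2
    rw [ZMod.pow_card_pow] at h2
    apply (ZMod.intCast_zmod_eq_zero_iff_dvd _ _).1
    push_cast
    exact h2
  refine ⟨hpr, hnr, ?_⟩
  have lte : ∀ a : ℕ, emultiplicity (p:ℤ) (r ^ p ^ a - 1) = emultiplicity (p:ℤ) (r - 1) + a := by
    intro a
    have := Int.emultiplicity_pow_sub_pow hp hodd (x := r) (y := 1) hpr hnr (p ^ a)
    rw [one_pow] at this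
    rw [this, hp.emultiplicity_pow_self]
  have h1 := (key (p^s)).2 dvd_rfl
  have h2 : ¬ (p:ℤ)^n ∣ r ^ p ^ (s-1) - 1 := by
    rw [key]
    intro h
    have := (Nat.pow_dvd_pow_iff_le_right hp.one_lt).1 h
    omega
  rw [pow_dvd_iff_le_emultiplicity, lte] at h1 h2
  have hfin : emultiplicity (p:ℤ) (r - 1) ≠ ⊤ := by
    intro h
    rw [h] at h2
    simp at h2
  obtain ⟨v, hv⟩ := ENat.ne_top_iff_exists.1 hfin
  rw [← hv] at h1 h2 ⊢
  norm_cast at *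
  omega

lemma aux_gcd (p n s : ℕ) (r : ℤ) (hp : p.Prime) (hodd : Odd p)
    (hs1 : 1 ≤ s) (hsn : s ≤ n - 1)
    (hr : Int.gcd r (p ^ n) = 1) (hord : orderOf ((r : ZMod (p ^ n))) = p ^ s) (j : ℕ) :
    Int.gcd (r ^ j - 1) ((p ^ n : ℕ) : ℤ) = p ^ (n - s) * Nat.gcd j (p ^ s) := by
  obtain ⟨hpr, hnr, he⟩ := aux_base p n s r hp hodd hs1 hsn hr hord
  have key : ∀ t : ℕ, p ^ t ∣ (r ^ j - 1).natAbs ↔ p ^ t ∣ p ^ (n - s) * j := by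
    intro t
    have := Int.emultiplicity_pow_sub_pow hp hodd (x := r) (y := 1) hpr hnr j
    rw [one_pow, he] at this
    rw [← Int.natCast_dvd, pow_dvd_iff_le_emultiplicity, emultiplicity_mul hp.prime,
      hp.emultiplicity_pow_self, ← this, Nat.cast_pow, pow_dvd_iff_le_emultiplicity]
  have e : p ^ n = p ^ (n - s) * p ^ s := by rw [← pow_add]; congr 1; omega
  rw [← Nat.gcd_mul_left, ← e, Int.gcd_eq_natAbs, Int.natAbs_natCast]
  apply Nat.dvd_antisymm
  · obtain ⟨t, ht, h⟩ := (Nat.dvd_prime_pow hp).1 (Nat.gcd_dvd_right (r ^ j - 1).natAbs (p ^ n))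
    have h3 := Nat.gcd_dvd_left (r ^ j - 1).natAbs (p ^ n)
    rw [h] at h3 ⊢
    exact Nat.dvd_gcd ((key t).1 h3) (pow_dvd_pow _ ht)
  · obtain ⟨t, ht, h⟩ := (Nat.dvd_prime_pow hp).1 (Nat.gcd_dvd_right (p ^ (n - s) * j) (p ^ n))
    have h3 := Nat.gcd_dvd_left (p ^ (n - s) * j) (p ^ n)
    rw [h] at h3 ⊢
    exact Nat.dvd_gcd ((key t).2 h3) (pow_dvd_pow _ ht)

/-- sum of gcds -/
lemma aux_sum (p m s : ℕ) (hp : p.Prime) (hsm : s ≤ m) (hm : 1 ≤ m) (hs : s + 1 ≤ 2 * m) :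
    (∑ j : Fin (p ^ m), ∑ l : Fin (p ^ m), (Nat.gcd (Nat.gcd j l) (p ^ s))) + p ^ (2 * m - s - 1)
      = p ^ (2 * m) + p ^ (2 * m - 1) := by
  induction s with
  | zero => 
    simp
    ring
  | succ s ih =>
    have ih := ih (by omega) (by omega)
    have step : ∀ j l : ℕ, Nat.gcd (Nat.gcd j l) (p ^ (s+1)) = Nat.gcd (Nat.gcd j l) (p ^ s) +
        (if p ^ (s+1) ∣ j then 1 else 0) * (if p ^ (s+1) ∣ l then 1 else 0) * (p^(s+1) - p^s) := by
      intro j l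
      have hle : p ^ s ≤ p ^ (s+1) := Nat.pow_le_pow_right hp.pos (by omega)
      by_cases h : p ^ (s+1) ∣ Nat.gcd j l
      · have h' := Nat.dvd_gcd_iff.1 h
        rw [Nat.gcd_eq_right h, Nat.gcd_eq_right ((pow_dvd_pow p (by omega : s ≤ s+1)).trans h),
          if_pos h'.1, if_pos h'.2]
        omega
      · have h0 : (if p ^ (s+1) ∣ j then 1 else 0) * (if p ^ (s+1) ∣ l then 1 else 0) = 0 := by
          rw [Nat.dvd_gcd_iff] at h
          split_ifs <;> simp_all
        rw [h0, zero_mul, add_zero]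
        apply Nat.dvd_antisymm
        · obtain ⟨t, ht, h2⟩ := (Nat.dvd_prime_pow hp).1 (Nat.gcd_dvd_right (j.gcd l) (p ^ (s+1)))
          have h3 := Nat.gcd_dvd_left (j.gcd l) (p ^ (s+1))
          rw [h2] at h3 ⊢
          have : t ≠ s + 1 := by rintro rfl; exact h h3
          exact Nat.dvd_gcd h3 (pow_dvd_pow _ (by omega))
        · exact Nat.gcd_dvd_gcd_of_dvd_right _ (pow_dvd_pow _ (by omega))
    have cnt : (∑ j : Fin (p ^ m), (if p ^ (s+1) ∣ (j:ℕ) then 1 else 0)) = p ^ (m - (s+1)) := by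
      rw [Fin.sum_univ_eq_sum_range (fun j => if p ^ (s+1) ∣ j then 1 else 0), ← Finset.card_filter]
      have e : p ^ m = p ^ (m - (s+1)) * p ^ (s+1) := by rw [← pow_add]; congr 1; omega
      have hpos : 0 < p ^ (s+1) := pow_pos hp.pos _
      rw [e, ← Finset.card_range (p ^ (m - (s+1)))]
      symm
      apply Finset.card_bij (fun i _ => i * p ^ (s+1))
      · intro i hi
        simp only [Finset.mem_filter, Finset.mem_range, Finset.card_range] at *
        exact ⟨Nat.mul_lt_mul_of_pos_right hi hpos, Dvd.intro_left _ rfl⟩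
      · intro i _ k _ h
        exact Nat.eq_of_mul_eq_mul_right hpos h
      · intro k hk
        simp only [Finset.mem_filter, Finset.mem_range, Finset.card_range] at *
        obtain ⟨h1, c, rfl⟩ := hk
        refine ⟨c, ?_, by ring⟩
        rw [mul_comm] at h1
        exact Nat.lt_of_mul_lt_mul_right h1
    have S : (∑ j : Fin (p ^ m), ∑ l : Fin (p ^ m), (Nat.gcd (Nat.gcd j l) (p ^ (s+1)))) =
       (∑ j : Fin (p ^ m), ∑ l : Fin (p ^ m), (Nat.gcd (Nat.gcd j l) (p ^ s))) +
        p ^ (m - (s+1)) * p ^ (m - (s+1)) * (p^(s+1) - p^s) := by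
      simp_rw [step, Finset.sum_add_distrib]
      congr 1
      simp_rw [← Finset.sum_mul, ← Finset.mul_sum]
      rw [← Finset.sum_mul, cnt]
    rw [S]
    obtain ⟨q, rfl⟩ : ∃ q, m = s + 1 + q := ⟨m - (s+1), by omega⟩
    have e1 : p ^ (s + 1 + q - (s+1)) * p ^ (s + 1 + q - (s+1)) * (p^(s+1) - p^s) 
       + p ^ (2 * (s + 1 + q) - (s+1) - 1) = p ^ (2 * (s + 1 + q) - s - 1) := by
      have a1 : s + 1 + q - (s+1) = q := by omega
      have a2 : 2 * (s + 1 + q) - (s+1) - 1 = q + q + s := by omega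
      have a3 : 2 * (s + 1 + q) - s - 1 = q + q + (s + 1) := by omega
      rw [a1, a2, a3, pow_add p (q+q), pow_add p (q+q), ← pow_add, ← mul_add]
      congr 1
      have hle : p ^ s ≤ p ^ (s+1) := Nat.pow_le_pow_right hp.pos (by omega)
      omega
    rw [add_assoc, e1, ih]

lemma aux_ker (N : ℕ) [NeZero N] (z : ℤ) :
    Nat.card {k : ZMod N // (z : ZMod N) * k = 0} = Int.gcd z N := by
  have h := IsAddCyclic.card_nsmulAddMonoidHom_ker (ZMod N) z.natAbs
  rw [Nat.card_zmod, Nat.gcd_comm] at h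
  rw [Int.gcd_eq_natAbs, Int.natAbs_natCast, ← h]
  apply Nat.card_congr
  apply Equiv.subtypeEquivRight
  intro k
  rw [AddMonoidHom.mem_ker, nsmulAddMonoidHom_apply, nsmul_eq_mul]
  rcases Int.natAbs_eq z with h | h
  · conv_lhs => rw [h]
    simp
  · conv_lhs => rw [h]
    simp

lemma aux_mult (N : ℕ) (z w : ℤ) (h : Int.gcd z N ∣ Int.gcd w N) :
    ∃ c : ZMod N, (w : ZMod N) = z * c := by
  have h1 : (Int.gcd z N : ℤ) ∣ w :=
    (Int.natCast_dvd_natCast.2 h).trans (Int.gcd_dvd_left ..)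
  obtain ⟨d, hd⟩ := h1
  have hb := Int.gcd_eq_gcd_ab z N
  refine ⟨(Int.gcdA z N : ℤ) * d, ?_⟩
  have h2 : (w : ZMod N) = ((Int.gcd z N * d : ℤ) : ZMod N) := by rw [← hd]
  rw [h2, hb]
  push_cast
  simp
  ring

lemma aux_pairs1 (N : ℕ) [NeZero N] (z w : ℤ) (h : Int.gcd z N ∣ Int.gcd w N) :
    Nat.card {q : ZMod N × ZMod N // (z : ZMod N) * q.2 = w * q.1} = N * Int.gcd z N := by
  obtain ⟨c, hc⟩ := aux_mult N z w h
  rw [← aux_ker N z]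
  have hP : N * Nat.card {k : ZMod N // (z : ZMod N) * k = 0} =
      Nat.card (ZMod N × {k : ZMod N // (z : ZMod N) * k = 0}) := by
    rw [Nat.card_prod, Nat.card_zmod]
  rw [hP]
  apply Nat.card_congr
  refine ⟨fun q => (q.1.1, ⟨q.1.2 - c * q.1.1, ?_⟩), fun t => ⟨(t.1, t.2.1 + c * t.1), ?_⟩, ?_, ?_⟩
  · have := q.2
    linear_combination this + (q.1.1) * hc
  · have := t.2.2
    linear_combination this - t.1 * hc
  · intro q; ext <;> simp
  · intro t; ext <;> simp

lemma aux_pairs (N : ℕ) [NeZero N] (z w : ℤ)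
    (h : Int.gcd z N ∣ Int.gcd w N ∨ Int.gcd w N ∣ Int.gcd z N) :
    Nat.card {q : ZMod N × ZMod N // (z : ZMod N) * q.2 = w * q.1} =
      N * Nat.gcd (Int.gcd z N) (Int.gcd w N) := by
  rcases h with h | h
  · rw [aux_pairs1 N z w h, Nat.gcd_eq_left h]
  · rw [Nat.gcd_eq_right h, ← aux_pairs1 N w z h]
    apply Nat.card_congr
    refine (Equiv.prodComm _ _).subtypeEquiv ?_
    intro q
    simp [eq_comm]

section
variable {G : Type} [Group G]

lemma aux_conj (a b : G) (r : ℤ) (hrel : b * a * b⁻¹ = a ^ r) (j : ℕ) (k : ℤ) :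
    b ^ j * a ^ k = a ^ (r ^ j * k) * b ^ j := by
  have h1 : ∀ k : ℤ, b * a ^ k = a ^ (r * k) * b := by
    intro k
    have : (b * a * b⁻¹) ^ k = b * a ^ k * b⁻¹ := conj_zpow
    rw [hrel, ← zpow_mul] at this
    rw [this]; group
  induction j generalizing k with
  | zero => simp
  | succ j ih =>
    rw [pow_succ, mul_assoc, h1, ← mul_assoc, ih, mul_assoc, ← pow_succ]
    congr 2
    ring

lemma aux_surj [Finite G] (a b : G) (r : ℤ) (hrel : b * a * b⁻¹ = a ^ r)
    (hgen : Subgroup.closure {a, b} = ⊤) (g : G) :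
    ∃ x ∈ Subgroup.zpowers a, ∃ y ∈ Subgroup.zpowers b, x * y = g := by
  have hN : (Subgroup.zpowers a).Normal := by
    rw [← Subgroup.normalizer_eq_top_iff, eq_top_iff, ← hgen, Subgroup.closure_le]
    have hA : a ∈ Subgroup.normalizer (Subgroup.zpowers a : Set G) :=
      Subgroup.le_normalizer (Subgroup.mem_zpowers a)
    have hB : b ∈ Subgroup.normalizer (Subgroup.zpowers a : Set G) := by
      apply Subgroup.mem_normalizer_fintype
      rintro _ ⟨k, rfl⟩
      refine ⟨r * k, ?_⟩
      have := aux_conj a b r hrel 1 k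
      simp only [pow_one] at this
      simp [this]
    rintro x (rfl | rfl)
    · exact hA
    · exact hB
  have htop : Subgroup.zpowers a ⊔ Subgroup.zpowers b = ⊤ := by
    rw [eq_top_iff, ← hgen, Subgroup.closure_le]
    rintro x (rfl | rfl)
    · exact Subgroup.mem_sup_left (Subgroup.mem_zpowers x)
    · exact Subgroup.mem_sup_right (Subgroup.mem_zpowers x)
  have hg : g ∈ ((Subgroup.zpowers a ⊔ Subgroup.zpowers b : Subgroup G) : Set G) := by
    rw [htop]; trivial
  rw [Subgroup.normal_mul] at hg
  exact hg

lemma aux_bij [Finite G] (N M : ℕ) [NeZero N] [NeZero M] (a b : G) (r : ℤ)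
    (hrel : b * a * b⁻¹ = a ^ r) (hgen : Subgroup.closure {a, b} = ⊤)
    (hcard : Nat.card G = N * M) (ha : orderOf a = N) (hb : orderOf b = M) :
    Function.Bijective (fun q : ZMod N × Fin M => a ^ (q.1.val : ℤ) * b ^ (q.2 : ℕ)) := by
  classical
  have := Fintype.ofFinite G
  rw [Fintype.bijective_iff_surjective_and_card]
  constructor
  · intro g
    obtain ⟨x, ⟨i, rfl⟩, y, hy, rfl⟩ := aux_surj a b r hrel hgen g
    rw [mem_zpowers_iff_mem_range_orderOf, hb] at hy
    simp only [Finset.mem_image, Finset.mem_range] at hy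
    obtain ⟨j, hj, rfl⟩ := hy
    refine ⟨((i : ZMod N), ⟨j, hj⟩), ?_⟩
    simp only
    congr 1
    rw [zpow_eq_zpow_iff_modEq, ha, ← ZMod.intCast_eq_intCast_iff]
    simp
  · rw [← Nat.card_eq_fintype_card (α := G), hcard]
    simp [ZMod.card]

lemma aux_comm (N : ℕ) [NeZero N] (a b : G) (r : ℤ) (hrel : b * a * b⁻¹ = a ^ r)
    (ha : orderOf a = N) (i k : ZMod N) (j l : ℕ) :
    Commute (a ^ (i.val : ℤ) * b ^ j) (a ^ (k.val : ℤ) * b ^ l) ↔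
      ((r ^ j - 1 : ℤ) : ZMod N) * k = ((r ^ l - 1 : ℤ) : ZMod N) * i := by
  have H : ∀ (x y : ℤ) (j l : ℕ), (a ^ x * b ^ j) * (a ^ y * b ^ l) =
      a ^ (x + r ^ j * y) * b ^ (j + l) := by
    intro x y j l
    rw [mul_assoc, ← mul_assoc (b ^ j), aux_conj a b r hrel, zpow_add, pow_add]
    simp only [mul_assoc]
  rw [Commute, SemiconjBy, H, H, add_comm l j, mul_left_inj, zpow_eq_zpow_iff_modEq, ha,
    ← ZMod.intCast_eq_intCast_iff]
  push_cast
  simp only [ZMod.natCast_zmod_val]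
  constructor
  · intro h; linear_combination h
  · intro h; linear_combination h
end

theorem stmt_14 (p n m s : ℕ) (r : ℤ) (hp : p.Prime) (hodd : Odd p)
    (hn : 2 ≤ n) (hm : 1 ≤ m) (hs1 : 1 ≤ s) (hsn : s ≤ n - 1) (hsm : s ≤ m)
    (hr : Int.gcd r (p ^ n) = 1) (hord : orderOf ((r : ZMod (p ^ n))) = p ^ s)
    (G : Type) [Group G] (a b : G)
    (hcard : Nat.card G = p ^ (n + m))
    (ha : orderOf a = p ^ n) (hb : orderOf b = p ^ m)
    (hrel : b * a * b⁻¹ = a ^ r)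
    (hgen : Subgroup.closure {a, b} = ⊤) :
    Nat.card (ConjClasses G) =
      p ^ (n + m - s) + p ^ (n + m - s - 1) - p ^ (n + m - 2 * s - 1) := by
  have hp0 : p ≠ 0 := hp.ne_zero
  have : NeZero (p ^ n) := ⟨pow_ne_zero _ hp0⟩
  have : NeZero (p ^ m) := ⟨pow_ne_zero _ hp0⟩
  have : Finite G := Nat.finite_of_card_ne_zero (by rw [hcard]; exact pow_ne_zero _ hp0)
  have hbij := aux_bij (p ^ n) (p ^ m) a b r hrel hgen (by rw [hcard, pow_add]) ha hb
  let e := Equiv.ofBijective _ hbij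
  have hcc := card_comm_eq_card_conjClasses_mul_card G
  have E1 : Nat.card { q : G × G // Commute q.1 q.2 } =
      Nat.card (Σ t : Fin (p ^ m) × Fin (p ^ m), {q : ZMod (p ^ n) × ZMod (p ^ n) //
        ((r ^ (t.1 : ℕ) - 1 : ℤ) : ZMod (p ^ n)) * q.2
          = ((r ^ (t.2 : ℕ) - 1 : ℤ) : ZMod (p ^ n)) * q.1}) := by
    symm
    apply Nat.card_congr
    refine Equiv.ofBijective (fun x => ⟨(e (x.2.1.1, x.1.1), e (x.2.1.2, x.1.2)),
      (aux_comm (p ^ n) a b r hrel ha _ _ _ _).2 x.2.2⟩) ⟨?_, ?_⟩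
    · rintro ⟨⟨j, l⟩, ⟨⟨i, k⟩, h⟩⟩ ⟨⟨j', l'⟩, ⟨⟨i', k'⟩, h'⟩⟩ hh
      have h1 := Prod.mk.inj (e.injective (Prod.mk.inj (Subtype.mk.inj hh)).1)
      have h2 := Prod.mk.inj (e.injective (Prod.mk.inj (Subtype.mk.inj hh)).2)
      obtain ⟨h3, h4⟩ := h1
      obtain ⟨h5, h6⟩ := h2
      dsimp only at h3 h4 h5 h6
      subst h3 h4 h5 h6
      rfl
    · rintro ⟨⟨x, y⟩, h⟩
      obtain ⟨⟨i, j⟩, rfl⟩ := e.surjective x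
      obtain ⟨⟨k, l⟩, rfl⟩ := e.surjective y
      exact ⟨⟨(j, l), ⟨(i, k), (aux_comm (p ^ n) a b r hrel ha _ _ _ _).1 h⟩⟩, rfl⟩
  have E2 : ∀ j l : ℕ, Nat.card {q : ZMod (p ^ n) × ZMod (p ^ n) //
        ((r ^ j - 1 : ℤ) : ZMod (p ^ n)) * q.2
          = ((r ^ l - 1 : ℤ) : ZMod (p ^ n)) * q.1} =
        p ^ n * p ^ (n - s) * Nat.gcd (Nat.gcd j l) (p ^ s) := by
    intro j l
    rw [aux_pairs]
    · rw [aux_gcd p n s r hp hodd hs1 hsn hr hord, aux_gcd p n s r hp hodd hs1 hsn hr hord,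
        Nat.gcd_mul_left, mul_assoc]
      congr 2
      apply Nat.dvd_antisymm
      · exact Nat.dvd_gcd
          (Nat.dvd_gcd ((Nat.gcd_dvd_left _ _).trans (Nat.gcd_dvd_left _ _))
            ((Nat.gcd_dvd_right _ _).trans (Nat.gcd_dvd_left _ _)))
          ((Nat.gcd_dvd_left _ _).trans (Nat.gcd_dvd_right _ _))
      · exact Nat.dvd_gcd (Nat.gcd_dvd_gcd_of_dvd_left _ (Nat.gcd_dvd_left _ _))
          (Nat.gcd_dvd_gcd_of_dvd_left _ (Nat.gcd_dvd_right _ _))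
    · obtain ⟨u, -, hu⟩ := (Nat.dvd_prime_pow hp).1
        (Int.natCast_dvd_natCast.1 (Int.gcd_dvd_right (r ^ j - 1) ((p ^ n : ℕ) : ℤ)))
      obtain ⟨v, -, hv⟩ := (Nat.dvd_prime_pow hp).1
        (Int.natCast_dvd_natCast.1 (Int.gcd_dvd_right (r ^ l - 1) ((p ^ n : ℕ) : ℤ)))
      rw [hu, hv]
      rcases le_total u v with h | h
      · exact Or.inl (pow_dvd_pow _ h)
      · exact Or.inr (pow_dvd_pow _ h)
  have S := aux_sum p m s hp hsm hm (by omega)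
  rw [E1, Nat.card_sigma, Fintype.sum_prod_type] at hcc
  simp only [E2, ← Finset.mul_sum] at hcc
  rw [hcard] at hcc
  set T := ∑ j : Fin (p ^ m), ∑ l : Fin (p ^ m), (Nat.gcd (Nat.gcd j l) (p ^ s))
  set K := Nat.card (ConjClasses G)
  suffices hK : K + p ^ (n + m - 2 * s - 1) = p ^ (n + m - s) + p ^ (n + m - s - 1) by omega
  apply Nat.eq_of_mul_eq_mul_right (pow_pos hp.pos (n + m))
  have f1 : p ^ (n + m - 2 * s - 1) * p ^ (n + m) = p ^ n * p ^ (n - s) * p ^ (2 * m - s - 1) := by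
    simp only [← pow_add]; congr 1; omega
  have f2 : p ^ (n + m - s) * p ^ (n + m) = p ^ n * p ^ (n - s) * p ^ (2 * m) := by
    simp only [← pow_add]; congr 1; omega
  have f3 : p ^ (n + m - s - 1) * p ^ (n + m) = p ^ n * p ^ (n - s) * p ^ (2 * m - 1) := by
    simp only [← pow_add]; congr 1; omega
  rw [add_mul, add_mul, f1, f2, f3, ← hcc, ← mul_add, ← mul_add, S]
end

section
/- Let p be an odd prime and let G be the split metacyclic p-group G = ⟨a, b | a^(p^n) = b^(p^m) = 1, b a b⁻¹ = a^r⟩ with n ≥ 2, m ≥ 1, gcd(r, p^n) = 1 and r of multiplicative order p^s modulo p^n, 1 ≤ s ≤ min{n−1, m}. For each t with 1 ≤ t ≤ s, the number of isomorphism classes of irreducible complex representations of G of degree p^t equals φ(p^{n−s})·p^{m−t} = (p^{n−s} − p^{n−s−1})·p^{m−t}. -/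
open CategoryTheory

/-- Isomorphism classes of irreducible (simple) finite-dimensional complex
representations of `G` of a given degree `d`: the setoid on simple objects of
`FDRep ℂ G` of dimension `d` whose relation is categorical isomorphism. -/
def repIsoSetoid (G : Type) [Monoid G] (d : ℕ) :
    Setoid {V : FDRep ℂ G // Simple V ∧ Module.finrank ℂ V = d} where
  r V W := Nonempty (V.1 ≅ W.1)
  iseqv := ⟨fun _ => ⟨Iso.refl _⟩, fun ⟨e⟩ => ⟨e.symm⟩, fun ⟨e⟩ ⟨f⟩ => ⟨e.trans f⟩⟩

/-- hom of FDRep from an equivariant linear map -/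
noncomputable def mkHomX {G : Type} [Group G] (V W : FDRep ℂ G) (f : V →ₗ[ℂ] W)
    (h : ∀ g v, f (V.ρ g v) = W.ρ g (f v)) : V ⟶ W :=
  ⟨FGModuleCat.ofHom f, fun g => by
    ext v
    exact h g v⟩

lemma mkHomX_apply {G : Type} [Group G] (V W : FDRep ℂ G) (f : V →ₗ[ℂ] W)
    (h : ∀ g v, f (V.ρ g v) = W.ρ g (f v)) : (mkHomX V W f h).hom.hom.hom = f := rfl

lemma hom_extX {G : Type} [Group G] {V W : FDRep ℂ G} (f g : V ⟶ W)
    (h : f.hom.hom.hom = g.hom.hom.hom) : f = g := by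
  ext v
  exact LinearMap.congr_fun h v

lemma hom_equivX {G : Type} [Group G] {V W : FDRep ℂ G} (f : V ⟶ W) (g : G) (v : V) :
    f.hom.hom.hom (V.ρ g v) = W.ρ g (f.hom.hom.hom v) := by
  have := f.comm g
  exact LinearMap.congr_fun (congrArg (fun x => x.hom.hom) this) v

lemma iso_of_equivX {G : Type} [Group G] (V W : FDRep ℂ G) (f : V ≃ₗ[ℂ] W)
    (h : ∀ g v, f (V.ρ g v) = W.ρ g (f v)) : Nonempty (V ≅ W) :=
  ⟨⟨mkHomX V W f.toLinearMap h, mkHomX W V f.symm.toLinearMap (fun g w => by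
      apply f.injective
      simp [h]), hom_extX _ _ (by ext v; exact f.symm_apply_apply v),
      hom_extX _ _ (by ext v; exact f.apply_symm_apply v)⟩⟩

lemma simple_topX {G : Type} [Group G] (V : FDRep ℂ G) (hV : Simple V) (W : Submodule ℂ V)
    (hW : ∀ g, ∀ w ∈ W, V.ρ g w ∈ W) (hne : W ≠ ⊥) : W = ⊤ := by
  let S : Subrepresentation (G := G) V.ρ := ⟨W, fun g w hw => hW g w hw⟩
  let Y : FDRep ℂ G := FDRep.of S.toRepresentation
  let i : Y ⟶ V := mkHomX Y V W.subtype (fun g v => rfl)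
  have hi : Mono i := by
    constructor
    intro Z f g hfg
    apply hom_extX
    ext z
    have := congrArg (fun x => x.hom.hom.hom z) hfg
    exact this
  have hi0 : i ≠ 0 := by
    intro h
    apply hne
    rw [eq_bot_iff]
    intro w hw
    have : i.hom.hom.hom (⟨w, hw⟩ : W) = 0 := by rw [h]; rfl
    exact this
  have := (Simple.mono_isIso_iff_nonzero i).2 hi0
  rw [eq_top_iff]
  intro v _
  have h2 : (inv i ≫ i).hom.hom.hom v = v := by rw [IsIso.inv_hom_id]; rfl
  have h3 : (inv i ≫ i).hom.hom.hom v = W.subtype ((inv i).hom.hom.hom v) := rfl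
  rw [← h2, h3]
  exact Subtype.prop _

lemma simple_of_scalarX {G : Type} [Group G] [Finite G] (V : FDRep ℂ G) (v : V) (hv : v ≠ 0)
    (h : ∀ f : V →ₗ[ℂ] V, (∀ g v, f (V.ρ g v) = V.ρ g (f v)) → ∃ c : ℂ, ∀ w, f w = c • w) :
    Simple V := by
  have : NeZero (Nat.card G : ℂ) := ⟨by exact_mod_cast Nat.card_pos.ne'⟩
  rw [FDRep.simple_iff_end_is_rank_one]
  rw [finrank_eq_one_iff_of_nonzero' (𝟙 V)]
  · intro f
    obtain ⟨c, hc⟩ := h f.hom.hom.hom (hom_equivX f)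
    refine ⟨c, hom_extX _ _ ?_⟩
    ext w
    exact (hc w).symm
  · intro h0
    apply hv
    have : (𝟙 V : V ⟶ V).hom.hom.hom v = 0 := by rw [h0]; rfl
    exact this

section core
variable {V : Type} [AddCommGroup V] [Module ℂ V] 

lemma pow_eigX (A : Module.End ℂ V) (v : V) (z : ℂ) (h : A v = z • v) (k : ℕ) :
    (A ^ k) v = z ^ k • v := by
  induction k with
  | zero => simp
  | succ k ih => rw [pow_succ', Module.End.mul_apply, ih, map_smul, h, smul_smul, pow_succ]

lemma eigX (A C : Module.End ℂ V) (r : ℕ) (hAC : A * C = C * A ^ r) (v : V) (z : ℂ)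
    (h : A v = z • v) (i : ℕ) : A ((C ^ i) v) = z ^ (r ^ i) • (C ^ i) v := by
  induction i with
  | zero => simpa using h
  | succ i ih =>
    rw [pow_succ' C, ← Module.End.mul_apply, ← mul_assoc, hAC, mul_assoc, Module.End.mul_apply,
      Module.End.mul_apply, pow_eigX A _ _ ih, map_smul, ← pow_mul, pow_succ r,
      Module.End.mul_apply]

lemma linindX (A C : Module.End ℂ V) (r : ℕ) (hAC : A * C = C * A ^ r) (v : V) (z : ℂ)
    (h : A v = z • v) (hne : ∀ i, (C ^ i) v ≠ 0) (d : ℕ)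
    (hinj : Set.InjOn (fun i : ℕ => z ^ (r ^ i)) (Set.Iio d)) :
    LinearIndependent ℂ (fun i : Fin d => (C ^ (i : ℕ)) v) := by
  refine Module.End.eigenvectors_linearIndependent' A (fun i : Fin d => z ^ (r ^ (i : ℕ))) ?_ _ ?_
  · intro i j hij
    exact Fin.ext (hinj i.2 j.2 hij)
  · intro i
    rw [Module.End.hasEigenvector_iff, Module.End.mem_eigenspace_iff]
    exact ⟨eigX A C r hAC v z h i, hne i⟩

lemma eigen_formX (A C : Module.End ℂ V) (r : ℕ) (hAC : A * C = C * A ^ r) (v : V) (z : ℂ)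
    (h : A v = z • v) (hne : ∀ i, (C ^ i) v ≠ 0) (d : ℕ)
    (hinj : Set.InjOn (fun i : ℕ => z ^ (r ^ i)) (Set.Iio d))
    (b : Module.Basis (Fin d) ℂ V) (hb : ∀ i, b i = (C ^ (i : ℕ)) v)
    (w : V) (hw : w ≠ 0) (x : ℂ) (hx : A w = x • w) :
    ∃ j < d, ∃ c : ℂ, c ≠ 0 ∧ w = c • (C ^ j) v ∧ x = z ^ (r ^ j) := by
  have hk : ∀ i, b.repr w i * (z ^ (r ^ (i : ℕ))) = x * b.repr w i := by
    have h1 : A w = ∑ i, (b.repr w i * (z ^ (r ^ (i : ℕ)))) • b i := by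
      conv_lhs => rw [← b.sum_repr w]
      rw [map_sum]
      refine Finset.sum_congr rfl fun i _ => ?_
      rw [map_smul, hb, eigX A C r hAC v z h, smul_smul]
    intro i
    have h2 := congrArg (fun u => b.repr u i) (h1.symm.trans hx)
    simp only [b.repr_sum_self] at h2
    simpa using h2
  have : ∃ j, b.repr w j ≠ 0 := by
    by_contra! hc
    apply hw
    apply b.repr.injective
    ext i; simp [hc]
  obtain ⟨j, hj⟩ := this
  have hxj : x = z ^ (r ^ (j : ℕ)) := by
    have := hk j
    rw [mul_comm] at this
    exact (mul_right_cancel₀ hj this).symm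
  refine ⟨j, j.2, b.repr w j, hj, ?_, hxj⟩
  conv_lhs => rw [← b.sum_repr w]
  rw [Finset.sum_eq_single j, hb]
  · intro i _ hij
    have := hk i
    rw [hxj, mul_comm] at this
    by_cases h0 : b.repr w i = 0
    · simp [h0]
    · exact absurd (Fin.ext (hinj i.2 j.2 (mul_right_cancel₀ h0 this))) hij
  · simp

end core

lemma closure_actX {G : Type} [Group G] [Finite G] (a c : G) (hgen : Subgroup.closure {a, c} = ⊤)
    (P : G → Prop) (h1 : P 1) (ha : P a) (hc : P c) (hm : ∀ x y, P x → P y → P (x * y)) (g : G) :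
    P g := by
  have hpow : ∀ x, P x → ∀ k : ℕ, P (x ^ k) := by
    intro x hx k
    induction k with
    | zero => simpa using h1
    | succ k ih => rw [pow_succ]; exact hm _ _ ih hx
  have hg : g ∈ Subgroup.closure {a, c} := by rw [hgen]; trivial
  induction hg using Subgroup.closure_induction with
  | mem x hx =>
    rcases hx with rfl | rfl
    · exact ha
    · exact hc
  | one => exact h1
  | mul x y _ _ hx hy => exact hm _ _ hx hy
  | inv x _ hx =>
    have : x⁻¹ = x ^ (orderOf x - 1) := by
      rw [inv_eq_iff_mul_eq_one, ← pow_succ', Nat.sub_add_cancel (orderOf_pos x), pow_orderOf_eq_one]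
    rw [this]; exact hpow _ hx _

lemma card_closureX {K : Type} [Group K] (x y : K) (N M r : ℕ) (hN : 0 < N) (hM : 0 < M)
    (hx : x ^ N = 1) (hy : y ^ M = 1) (h : x * y = y * x ^ r) :
    Finite (Subgroup.closure {x, y}) ∧ Nat.card (Subgroup.closure {x, y}) ≤ N * M := by
  have hxy : ∀ i, x ^ i * y = y * x ^ (r * i) := by
    intro i
    induction i with
    | zero => simp
    | succ i ih => rw [pow_succ', mul_assoc, ih, ← mul_assoc, h, mul_assoc, ← pow_add]; ring_nf
  have hxyk : ∀ k i, ∃ i', x ^ i * y ^ k = y ^ k * x ^ i' := by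
    intro k
    induction k with
    | zero => intro i; exact ⟨i, by simp⟩
    | succ k ih =>
      intro i
      obtain ⟨i', h'⟩ := ih i
      exact ⟨r * i', by rw [pow_succ, ← mul_assoc, h', mul_assoc, hxy, mul_assoc]⟩
  have hmem : ∀ g ∈ Subgroup.closure {x, y}, ∃ q : Fin M × Fin N, y ^ (q.1 : ℕ) * x ^ (q.2 : ℕ) = g := by
    have red : ∀ i j : ℕ, ∃ q : Fin M × Fin N, y ^ (q.1 : ℕ) * x ^ (q.2 : ℕ) = y ^ j * x ^ i := by
      intro i j
      refine ⟨(⟨j % M, Nat.mod_lt _ hM⟩, ⟨i % N, Nat.mod_lt _ hN⟩), ?_⟩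
      simp only
      rw [← pow_eq_pow_mod j hy, ← pow_eq_pow_mod i hx]
    have hX : x⁻¹ = x ^ (N - 1) := by
      rw [inv_eq_iff_mul_eq_one, ← pow_succ', Nat.sub_add_cancel hN, hx]
    have hY : y⁻¹ = y ^ (M - 1) := by
      rw [inv_eq_iff_mul_eq_one, ← pow_succ', Nat.sub_add_cancel hM, hy]
    have stepx : ∀ g k, (∃ q : Fin M × Fin N, y ^ (q.1 : ℕ) * x ^ (q.2 : ℕ) = g) →
        ∃ q : Fin M × Fin N, y ^ (q.1 : ℕ) * x ^ (q.2 : ℕ) = g * x ^ k := by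
      rintro g k ⟨q, rfl⟩
      rw [mul_assoc, ← pow_add]
      exact red _ _
    have stepy : ∀ g k, (∃ q : Fin M × Fin N, y ^ (q.1 : ℕ) * x ^ (q.2 : ℕ) = g) →
        ∃ q : Fin M × Fin N, y ^ (q.1 : ℕ) * x ^ (q.2 : ℕ) = g * y ^ k := by
      rintro g k ⟨q, rfl⟩
      obtain ⟨i', h'⟩ := hxyk k q.2
      rw [mul_assoc, h', ← mul_assoc, ← pow_add]
      exact red _ _
    intro g hg
    induction hg using Subgroup.closure_induction_right with
    | one => simpa using red 0 0
    | mul_right g hg u hu ih =>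
      rcases hu with rfl | rfl
      · simpa using stepx g 1 ih
      · simpa using stepy g 1 ih
    | mul_inv_cancel g hg u hu ih =>
      rcases hu with rfl | rfl
      · rw [hX]; exact stepx g _ ih
      · rw [hY]; exact stepy g _ ih
  choose f hf using fun g : Subgroup.closure {x, y} => hmem g.1 g.2
  have hfi : Function.Injective f := by
    intro g g' hgg
    apply Subtype.ext
    rw [← hf g, ← hf g', hgg]
  refine ⟨Finite.of_injective f hfi, ?_⟩
  calc _ ≤ Nat.card (Fin M × Fin N) := Nat.card_le_card_of_injective f hfi
    _ = N * M := by simp [mul_comm]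

lemma liftX {G K : Type} [Group G] [Group K] (a c : G) (N M r : ℕ) (hN : 0 < N) (hM : 0 < M)
    (hcard : Nat.card G = N * M) (hgen : Subgroup.closure {a, c} = ⊤)
    (ha : a ^ N = 1) (hc : c ^ M = 1) (h : a * c = c * a ^ r)
    (A C : K) (hA : A ^ N = 1) (hC : C ^ M = 1) (h' : A * C = C * A ^ r) :
    ∃ f : G →* K, f a = A ∧ f c = C := by
  obtain ⟨hfin, hle⟩ := card_closureX (K := G × K) (a, A) (c, C) N M r hN hM
    (by simp [Prod.pow_mk, ha, hA]) (by simp [Prod.pow_mk, hc, hC]) (by simp [h, h'])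
  let H : Subgroup (G × K) := Subgroup.closure {(a, A), (c, C)}
  let π : H →* G := (MonoidHom.fst G K).comp H.subtype
  have hs : Function.Surjective π := by
    rw [← MonoidHom.range_eq_top, eq_top_iff, ← hgen, Subgroup.closure_le]
    rintro u (rfl | rfl)
    · exact ⟨⟨(u, A), Subgroup.subset_closure (by simp)⟩, rfl⟩
    · exact ⟨⟨(u, C), Subgroup.subset_closure (by simp)⟩, rfl⟩
  have hbij : Function.Bijective π := by
    have : Finite H := hfin
    refine Function.Surjective.bijective_of_nat_card_le hs ?_
    rw [hcard]; exact hle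
  let e := MulEquiv.ofBijective π hbij
  refine ⟨((MonoidHom.snd G K).comp H.subtype).comp e.symm.toMonoidHom, ?_, ?_⟩
  · have : e.symm a = ⟨(a, A), Subgroup.subset_closure (by simp)⟩ := by
      rw [MulEquiv.symm_apply_eq]; rfl
    simp [this]
  · have : e.symm c = ⟨(c, C), Subgroup.subset_closure (by simp)⟩ := by
      rw [MulEquiv.symm_apply_eq]; rfl
    simp [this]

section reps
variable {G : Type} [Group G]

lemma rho_powX (V : FDRep ℂ G) (c : G) (i : ℕ) (v : V) : V.ρ (c ^ i) v = ((V.ρ c) ^ i) v := by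
  rw [map_pow]

lemma rho_neX (V : FDRep ℂ G) (c : G) (v : V) (hv : v ≠ 0) (i : ℕ) :
    ((V.ρ c) ^ i) v ≠ 0 := by
  rw [← rho_powX]
  intro h
  apply hv
  have : V.ρ ((c ^ i)⁻¹) (V.ρ (c ^ i) v) = v := by
    rw [← Module.End.mul_apply, ← map_mul, inv_mul_cancel, map_one]; rfl
  rw [← this, h, map_zero]

lemma rho_relX (V : FDRep ℂ G) (a c : G) (r : ℕ) (h : a * c = c * a ^ r) :
    V.ρ a * V.ρ c = V.ρ c * (V.ρ a) ^ r := by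
  rw [← map_pow, ← map_mul, ← map_mul, h]

/-- `(z, l)` occurs in `V` -/
def OccX (a c : G) (d : ℕ) (V : FDRep ℂ G) (z l : ℂ) : Prop :=
  ∃ v : V, v ≠ 0 ∧ V.ρ a v = z • v ∧ ((V.ρ c) ^ d) v = l • v

lemma basisX (V : FDRep ℂ G) (a c : G) (r d : ℕ) (h : a * c = c * a ^ r)
    (hd : 0 < d) (hV : Module.finrank ℂ V = d) (z : ℂ)
    (hinj : Set.InjOn (fun i : ℕ => z ^ (r ^ i)) (Set.Iio d))
    (v : V) (hv : v ≠ 0) (hz : V.ρ a v = z • v) :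
    ∃ b : Module.Basis (Fin d) ℂ V, ∀ i, b i = ((V.ρ c) ^ (i : ℕ)) v := by
  have : Nonempty (Fin d) := ⟨⟨0, hd⟩⟩
  have hl := linindX (V.ρ a) (V.ρ c) r (rho_relX V a c r h) v z hz (rho_neX V c v hv) d hinj
  refine ⟨basisOfLinearIndependentOfCardEqFinrank hl (by simp [hV]), ?_⟩
  intro i
  simp

lemma simpleX [Finite G] (V : FDRep ℂ G) (a c : G) (r d : ℕ) (h : a * c = c * a ^ r)
    (hd : 0 < d) (hV : Module.finrank ℂ V = d) (z l : ℂ)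
    (hinj : Set.InjOn (fun i : ℕ => z ^ (r ^ i)) (Set.Iio d))
    (hocc : OccX a c d V z l) : Simple V := by
  obtain ⟨v, hv, hz, hl⟩ := hocc
  obtain ⟨b, hb⟩ := basisX V a c r d h hd hV z hinj v hv hz
  refine simple_of_scalarX V v hv fun f hf => ?_
  have hfv : V.ρ a (f v) = z • f v := by rw [← hf, hz, map_smul]
  have key : ∃ k : ℂ, f v = k • v := by
    by_cases h0 : f v = 0
    · exact ⟨0, by simp [h0]⟩
    obtain ⟨j, hj, k, hk, hfk, hzj⟩ := eigen_formX (V.ρ a) (V.ρ c) r (rho_relX V a c r h) v z hz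
      (rho_neX V c v hv) d hinj b hb (f v) h0 z hfv
    have : j = 0 := hinj hj hd (by simpa using hzj.symm)
    subst this
    exact ⟨k, by simpa using hfk⟩
  obtain ⟨k, hk⟩ := key
  refine ⟨k, fun w => ?_⟩
  have : f = k • LinearMap.id := by
    apply b.ext
    intro i
    rw [hb, ← rho_powX, hf, hk]
    simp
  rw [this]; rfl

lemma uniqueX [Finite G] (V W : FDRep ℂ G) (a c : G) (r d : ℕ) (h : a * c = c * a ^ r)
    (hgen : Subgroup.closure {a, c} = ⊤)
    (hd : 0 < d) (hV : Module.finrank ℂ V = d) (hW : Module.finrank ℂ W = d) (z l : ℂ)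
    (hinj : Set.InjOn (fun i : ℕ => z ^ (r ^ i)) (Set.Iio d))
    (hocc : OccX a c d V z l) (hocc' : OccX a c d W z l) : Nonempty (V ≅ W) := by
  obtain ⟨v, hv, hz, hl⟩ := hocc
  obtain ⟨b, hb⟩ := basisX V a c r d h hd hV z hinj v hv hz
  obtain ⟨v', hv', hz', hl'⟩ := hocc'
  obtain ⟨b', hb'⟩ := basisX W a c r d h hd hW z hinj v' hv' hz'
  let T : V ≃ₗ[ℂ] W := b.equiv b' (Equiv.refl _)
  have hT : ∀ i < d, T (((V.ρ c) ^ i) v) = ((W.ρ c) ^ i) v' := by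
    intro i hi
    have := b.equiv_apply ⟨i, hi⟩ b' (Equiv.refl _)
    rw [hb, Equiv.refl_apply, hb'] at this
    exact this
  have hT' : ∀ i ≤ d, T (((V.ρ c) ^ i) v) = ((W.ρ c) ^ i) v' := by
    intro i hi
    rcases hi.lt_or_eq with hi | rfl
    · exact hT i hi
    · have h0 := hT 0 hd
      simp only [pow_zero, Module.End.one_apply] at h0
      rw [hl, hl', map_smul, h0]
  refine iso_of_equivX V W T fun g => ?_
  refine closure_actX a c hgen (fun g => ∀ u, T (V.ρ g u) = W.ρ g (T u)) ?_ ?_ ?_ ?_ g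
  · intro u; simp
  · intro u
    have : T.toLinearMap ∘ₗ (V.ρ a) = (W.ρ a) ∘ₗ T.toLinearMap := by
      apply b.ext
      intro i
      simp only [LinearMap.comp_apply, LinearEquiv.coe_coe]
      rw [hb, eigX _ _ r (rho_relX V a c r h) v z hz, map_smul, hT i i.2,
        eigX _ _ r (rho_relX W a c r h) v' z hz']
    exact LinearMap.congr_fun this u
  · intro u
    have : T.toLinearMap ∘ₗ (V.ρ c) = (W.ρ c) ∘ₗ T.toLinearMap := by
      apply b.ext
      intro i
      simp only [LinearMap.comp_apply, LinearEquiv.coe_coe]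
      rw [hb, hT i i.2, ← Module.End.mul_apply, ← Module.End.mul_apply, ← pow_succ', ← pow_succ',
        hT' _ i.2]
    exact LinearMap.congr_fun this u
  · intro x y hx hy u
    rw [map_mul, map_mul, Module.End.mul_apply, Module.End.mul_apply, hx, hy]

lemma occ_isoX (a c : G) (d : ℕ) (V W : FDRep ℂ G) (e : V ≅ W) (z l : ℂ)
    (h : OccX a c d V z l) : OccX a c d W z l := by
  obtain ⟨v, hv, hz, hl⟩ := h
  refine ⟨e.hom.hom.hom.hom v, ?_, ?_, ?_⟩
  · intro h0
    apply hv
    have : (e.hom ≫ e.inv).hom.hom.hom v = v := by rw [e.hom_inv_id]; rfl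
    have h3 : (e.hom ≫ e.inv).hom.hom.hom v = e.inv.hom.hom.hom (e.hom.hom.hom.hom v) := rfl
    rw [← this, h3, h0, map_zero]
  · rw [← hom_equivX, hz, map_smul]
  · rw [← rho_powX, ← hom_equivX, rho_powX, hl, map_smul]

lemma iterX (r : ℕ) (z : ℂ) (i : ℕ) : (fun x : ℂ => x ^ r)^[i] z = z ^ (r ^ i) := by
  induction i with
  | zero => simp
  | succ i ih => rw [Function.iterate_succ_apply', ih, ← pow_mul, pow_succ]

lemma injX (r : ℕ) (z : ℂ) :
    Set.InjOn (fun i : ℕ => z ^ (r ^ i)) (Set.Iio (Function.minimalPeriod (fun x : ℂ => x ^ r) z)) := by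
  have := Function.iterate_injOn_Iio_minimalPeriod (f := fun x : ℂ => x ^ r) (x := z)
  simpa only [iterX] using this

lemma existsX [Finite G] (V : FDRep ℂ G) (hV : Simple V) (a c : G) (N M r d : ℕ)
    (h : a * c = c * a ^ r) (hM : 0 < M)
    (hgen : Subgroup.closure {a, c} = ⊤) (ha : a ^ N = 1) (hc : c ^ M = 1) (hdM : d ∣ M)
    (hd : 0 < d) (hVd : Module.finrank ℂ V = d) :
    ∃ z l : ℂ, z ^ N = 1 ∧ Function.minimalPeriod (fun x : ℂ => x ^ r) z = d ∧ l ^ (M / d) = 1 ∧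
      OccX a c d V z l := by
  have hnt : Nontrivial V := Module.nontrivial_of_finrank_pos (R := ℂ) (by omega)
  set A := V.ρ a with hA
  set C := V.ρ c with hC
  have hAC : A * C = C * A ^ r := rho_relX V a c r h
  obtain ⟨z, hz⟩ := Module.End.exists_eigenvalue A
  obtain ⟨u, hu⟩ := hz.exists_hasEigenvector
  have hu1 : A u = z • u := hu.apply_eq_smul
  have hu0 : u ≠ 0 := hu.2
  have hzN : z ^ N = 1 := by
    have := pow_eigX A u z hu1 N
    rw [hA, ← map_pow, ha, map_one, Module.End.one_apply] at this
    have h2 : (1 - z ^ N) • u = 0 := by rw [sub_smul, one_smul, ← this, sub_self]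
    rcases smul_eq_zero.1 h2 with h3 | h3
    · exact (sub_eq_zero.1 h3).symm
    · exact absurd h3 hu0
  have hzM : z ^ (r ^ M) = z := by
    have := eigX A C r hAC u z hu1 M
    rw [hC, ← map_pow, hc, map_one, Module.End.one_apply, hu1] at this
    exact (smul_left_injective ℂ hu0 this).symm
  set e := Function.minimalPeriod (fun x : ℂ => x ^ r) z with he
  have hper : z ^ (r ^ e) = z := by
    rw [← iterX]; exact Function.isPeriodicPt_minimalPeriod _ _
  have hepos : 0 < e := Function.IsPeriodicPt.minimalPeriod_pos hM (by
    show _ = _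
    rw [iterX, hzM])
  let E := Module.End.eigenspace A z
  have hmap : ∀ w ∈ E, (C ^ e) w ∈ E := by
    intro w hw
    rw [Module.End.mem_eigenspace_iff] at hw ⊢
    rw [eigX A C r hAC w z hw, hper]
  have hEnt : Nontrivial E := ⟨⟨⟨u, hu.1⟩, 0, fun h => hu0 (congrArg Subtype.val h)⟩⟩
  obtain ⟨l, hl⟩ := Module.End.exists_eigenvalue ((C ^ e).restrict hmap)
  obtain ⟨v, hv⟩ := hl.exists_hasEigenvector
  have hv0 : (v : V) ≠ 0 := fun h => hv.2 (Subtype.ext h)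
  have hvz : A (v : V) = z • (v : V) := Module.End.mem_eigenspace_iff.1 v.2
  have hvl : (C ^ e) (v : V) = l • (v : V) := congrArg Subtype.val hv.apply_eq_smul
  have hli := linindX A C r hAC v z hvz (rho_neX V c v hv0) e (injX r z)
  let S : Submodule ℂ V := Submodule.span ℂ (Set.range fun i : Fin e => (C ^ (i : ℕ)) (v : V))
  have hmemS : ∀ i ≤ e, (C ^ i) (v : V) ∈ S := by
    have hlt : ∀ i < e, (C ^ i) (v : V) ∈ S := fun i hi =>
      Submodule.subset_span ⟨⟨i, hi⟩, rfl⟩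
    intro i hi
    rcases hi.lt_or_eq with hi | rfl
    · exact hlt i hi
    · rw [hvl]; exact S.smul_mem _ (by simpa using hlt 0 hepos)
  have hStop : S = ⊤ := by
    apply simple_topX V hV S
    · intro g
      refine closure_actX a c hgen (fun g => ∀ w ∈ S, V.ρ g w ∈ S) ?_ ?_ ?_ ?_ g
      · intro w hw; simpa using hw
      · intro w hw
        have : S ≤ S.comap A := by
          rw [Submodule.span_le]
          rintro _ ⟨i, rfl⟩
          simp only [Submodule.comap_coe, Set.mem_preimage, SetLike.mem_coe]
          rw [eigX A C r hAC v z hvz]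
          exact S.smul_mem _ (hmemS i i.2.le)
        exact this hw
      · intro w hw
        have : S ≤ S.comap C := by
          rw [Submodule.span_le]
          rintro _ ⟨i, rfl⟩
          simp only [Submodule.comap_coe, Set.mem_preimage, SetLike.mem_coe]
          rw [← Module.End.mul_apply, ← pow_succ']
          exact hmemS _ i.2
        exact this hw
      · intro x y hx hy w hw
        rw [map_mul]
        exact hx _ (hy _ hw)
    · intro hb
      have := hmemS 0 (Nat.zero_le _)
      rw [hb, Submodule.mem_bot] at this
      exact hv0 (by simpa using this)
  have hed : e = d := by
    have h1 := finrank_span_eq_card hli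
    rw [show Submodule.span ℂ (Set.range fun i : Fin e => (C ^ (i : ℕ)) (v : V)) = ⊤ from hStop,
      finrank_top, Fintype.card_fin] at h1
    rw [← hVd]; exact h1.symm
  refine ⟨z, l, hzN, hed, ?_, v, hv0, hvz, hed ▸ hvl⟩
  rw [hed] at hvl
  have := pow_eigX (C ^ d) v l hvl (M / d)
  rw [← pow_mul, Nat.mul_div_cancel' hdM, hC, ← map_pow, hc, map_one, Module.End.one_apply] at this
  have h3 : (1 : ℂ) • (v : V) = l ^ (M / d) • (v : V) := by rw [one_smul]; exact this
  exact (smul_left_injective ℂ hv0 h3).symm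

lemma modelX (a c : G) (N M r d : ℕ) (hN : 0 < N) (hM : 0 < M)
    (hcard : Nat.card G = N * M) (hgen : Subgroup.closure {a, c} = ⊤)
    (ha : a ^ N = 1) (hc : c ^ M = 1) (h : a * c = c * a ^ r) (hdM : d ∣ M)
    (hd : 0 < d) (z l : ℂ) (hz : z ^ N = 1) (hzd : z ^ (r ^ d) = z) (hl : l ^ (M / d) = 1) :
    ∃ V : FDRep ℂ G, Module.finrank ℂ V = d ∧ OccX a c d V z l := by
  have : NeZero d := ⟨hd.ne'⟩
  obtain ⟨μ, hμ⟩ := IsAlgClosed.exists_pow_nat_eq l hd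
  let w : ZMod d → ℂ := fun i => z ^ (r ^ i.val)
  have hmod : ∀ k : ℕ, z ^ (r ^ (k % d)) = z ^ (r ^ k) := by
    intro k
    have hz' : Function.IsPeriodicPt (fun x : ℂ => x ^ r) d z := by
      show _ = _
      rw [iterX, hzd]
    have := hz'.iterate_mod_apply k
    simpa only [iterX] using this
  have hw : ∀ i, w (i + 1) = w i ^ r := by
    intro i
    have h1 : (i + 1 : ZMod d).val = (i.val + 1) % d := by
      rw [← ZMod.val_natCast, Nat.cast_add, Nat.cast_one, ZMod.natCast_zmod_val]
    simp only [w]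
    rw [h1, hmod, ← pow_mul, pow_succ]
  let A : Module.End ℂ (ZMod d → ℂ) :=
    { toFun := fun f i => w i * f i
      map_add' := fun f g => by ext i; simp [mul_add]
      map_smul' := fun k f => by ext i; simp; ring }
  let C : Module.End ℂ (ZMod d → ℂ) :=
    { toFun := fun f i => μ * f (i - 1)
      map_add' := fun f g => by ext i; simp [mul_add]
      map_smul' := fun k f => by ext i; simp; ring }
  have hAk : ∀ k f i, (A ^ k) f i = w i ^ k * f i := by
    intro k
    induction k with
    | zero => intro f i; simp
    | succ k ih =>
      intro f i
      rw [pow_succ, Module.End.mul_apply, ih, pow_succ, mul_assoc]; rfl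
  have hCk : ∀ (k : ℕ) (f : ZMod d → ℂ) (i : ZMod d), (C ^ k) f i = μ ^ k * f (i - k) := by
    intro k
    induction k with
    | zero => intro f i; simp
    | succ k ih =>
      intro f i
      rw [pow_succ, Module.End.mul_apply, ih, pow_succ, mul_assoc]
      show _ * (μ * f (i - k - 1)) = _
      rw [Nat.cast_succ, sub_sub]
  have hA : A ^ N = 1 := by
    refine LinearMap.ext fun f => funext fun i => ?_
    rw [hAk]
    simp only [w]
    rw [← pow_mul, mul_comm (r ^ _) N, pow_mul, hz]; simp
  have hμM : μ ^ M = 1 := by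
    rw [← Nat.mul_div_cancel' hdM, pow_mul, hμ, hl]
  have hC : C ^ M = 1 := by
    refine LinearMap.ext fun f => funext fun i => ?_
    rw [hCk, hμM, (ZMod.natCast_eq_zero_iff M d).2 hdM]; simp
  have hAC : A * C = C * A ^ r := by
    refine LinearMap.ext fun f => funext fun i => ?_
    show w i * (μ * f (i - 1)) = μ * ((A ^ r) f (i - 1))
    rw [hAk, ← hw, sub_add_cancel]; ring
  obtain ⟨F, hFa, hFc⟩ := liftX (K := (Module.End ℂ (ZMod d → ℂ))ˣ) a c N M r hN hM hcard hgen ha hc h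
    (Units.ofPowEqOne A N hA hN.ne') (Units.ofPowEqOne C M hC hM.ne')
    (Units.pow_ofPowEqOne _ _) (Units.pow_ofPowEqOne _ _) (by
      ext1; simpa using hAC)
  let ρ : Representation ℂ G (ZMod d → ℂ) := (Units.coeHom _).comp F
  have hρa : ρ a = A := by simp [ρ, hFa]
  have hρc : ρ c = C := by simp [ρ, hFc]
  refine ⟨FDRep.of ρ, ?_, ?_⟩
  · show Module.finrank ℂ (ZMod d → ℂ) = d
    simp [ZMod.card]
  · refine ⟨(Pi.single 0 1 : ZMod d → ℂ), ?_, ?_, ?_⟩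
    · intro h0
      have : (Pi.single 0 1 : ZMod d → ℂ) 0 = 0 := congrFun h0 0
      simp at this
    · show ρ a (Pi.single 0 1 : ZMod d → ℂ) = z • (Pi.single 0 1 : ZMod d → ℂ)
      rw [hρa]
      funext i
      show w i * _ = _
      by_cases hi : i = 0
      · subst hi; simp [w]
      · simp [hi]
    · show ((ρ c) ^ d) (Pi.single 0 1 : ZMod d → ℂ) = l • (Pi.single 0 1 : ZMod d → ℂ)
      rw [hρc]
      funext i
      rw [hCk, hμ]
      simp
end reps
lemma ltX (p r n s : ℕ) (hp : p.Prime) (hodd : Odd p) (hs1 : 1 ≤ s) (hsn : s ≤ n - 1)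
    (hord : orderOf ((r : ZMod (p ^ n))) = p ^ s) :
    1 < r ∧ ∀ k j : ℕ, p ^ k ∣ r ^ (p ^ j) - 1 ↔ k ≤ (n - s) + j := by
  haveI : Fact p.Prime := ⟨hp⟩
  have hn0 : n ≠ 0 := by omega
  have hps : 1 < p ^ s := Nat.one_lt_pow (by omega) hp.one_lt
  have hmain : ∀ k i : ℕ, 0 < r → (p ^ k ∣ r ^ i - 1 ↔ (r : ZMod (p ^ k)) ^ i = 1) := by
    intro k i hr
    rw [← ZMod.natCast_eq_zero_iff, Nat.cast_sub (Nat.one_le_pow _ _ hr), sub_eq_zero]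
    push_cast; rfl
  have hr1 : 1 < r := by
    rcases Nat.lt_or_ge 1 r with h | h
    · exact h
    exfalso
    interval_cases r
    · have h1 : (0 : ZMod (p ^ n)) ^ (p ^ s) = 1 := by
        have := pow_orderOf_eq_one (((0 : ℕ) : ZMod (p ^ n)))
        rw [hord] at this; simpa using this
      rw [zero_pow (by omega)] at h1
      haveI : Fact (1 < p ^ n) := ⟨Nat.one_lt_pow hn0 hp.one_lt⟩
      exact zero_ne_one h1
    · simp at hord; omega
  have hdv : ∀ i, p ^ n ∣ r ^ i - 1 ↔ p ^ s ∣ i := by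
    intro i
    rw [hmain n i (by omega), ← hord, orderOf_dvd_iff_pow_eq_one]
  have hpr : p ∣ r - 1 := by
    have h1 : p ∣ r ^ (p ^ s) - 1 := (dvd_pow_self p hn0).trans ((hdv _).2 dvd_rfl)
    have h2 := (hmain 1 (p ^ s) (by omega)).1 (by simpa using h1)
    rw [pow_one] at h2
    rw [ZMod.pow_card_pow] at h2
    have h3 := (hmain 1 1 (by omega)).2 (by rw [pow_one, pow_one]; exact h2)
    simpa using h3
  have hpr' : ¬ p ∣ r := by
    intro h
    have := (Nat.dvd_sub_iff_right (by omega) h).1 hpr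
    exact hp.one_lt.ne' (Nat.dvd_one.1 this)
  have hl : ∀ k j : ℕ, p ^ k ∣ r ^ (p ^ j) - 1 ↔ k ≤ padicValNat p (r - 1) + j := by
    intro k j
    have h1 := padicValNat.pow_sub_pow (p := p) hodd (x := r) (y := 1) hr1 hpr hpr'
      (n := p ^ j) (pow_pos hp.pos _).ne'
    rw [one_pow, padicValNat.prime_pow] at h1
    rw [padicValNat_dvd_iff_le, h1]
    have := Nat.one_lt_pow (pow_pos hp.pos j).ne' hr1
    omega
  have h1 := (hl n s).1 ((hdv _).2 dvd_rfl)
  have h2 : ¬ n ≤ padicValNat p (r - 1) + (s - 1) := by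
    rw [← hl, hdv, Nat.pow_dvd_pow_iff_le_right hp.one_lt]
    omega
  have hv : padicValNat p (r - 1) = n - s := by omega
  rw [hv] at hl
  exact ⟨hr1, hl⟩

lemma minperX (p r n s t : ℕ) (hp : p.Prime) (hodd : Odd p) (hs1 : 1 ≤ s) (hsn : s ≤ n - 1)
    (hord : orderOf ((r : ZMod (p ^ n))) = p ^ s) (ht : 1 ≤ t) (hts : t ≤ s) (z : ℂ) :
    (z ^ (p ^ n) = 1 ∧ Function.minimalPeriod (fun x : ℂ => x ^ r) z = p ^ t) ↔
      IsPrimitiveRoot z (p ^ (n - s + t)) := by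
  obtain ⟨hr1, hl⟩ := ltX p r n s hp hodd hs1 hsn hord
  have key : ∀ k, orderOf z = p ^ k → ∀ j,
      (Function.minimalPeriod (fun x : ℂ => x ^ r) z ∣ p ^ j ↔ k ≤ n - s + j) := by
    intro k hk j
    have hz0 : z ≠ 0 := by
      rintro rfl
      have := pow_orderOf_eq_one (0 : ℂ)
      rw [hk, zero_pow (pow_pos hp.pos _).ne'] at this
      exact zero_ne_one this
    rw [← Function.isPeriodicPt_iff_minimalPeriod_dvd, ← hl, ← hk, orderOf_dvd_iff_pow_eq_one]
    show (_ = _) ↔ _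
    rw [iterX]
    have h1 : z ^ (r ^ (p ^ j)) = z ^ (r ^ (p ^ j) - 1) * z := by
      rw [← pow_succ, Nat.sub_add_cancel (Nat.one_le_pow _ _ (by omega))]
    rw [h1]
    constructor
    · intro h; exact mul_right_cancel₀ hz0 (by rw [h, one_mul])
    · intro h; rw [h, one_mul]
  constructor
  · rintro ⟨hz, hmp⟩
    obtain ⟨k, hkn, hk⟩ := (Nat.dvd_prime_pow hp).1 (orderOf_dvd_of_pow_eq_one hz)
    have h1 := (key k hk t).1 (by rw [hmp])
    have h2 : ¬ k ≤ n - s + (t - 1) := by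
      rw [← key k hk, hmp, Nat.pow_dvd_pow_iff_le_right hp.one_lt]; omega
    have : k = n - s + t := by omega
    rw [← this, ← hk]
    exact IsPrimitiveRoot.orderOf z
  · intro hz
    have hk := hz.eq_orderOf.symm
    refine ⟨?_, ?_⟩
    · exact hz.pow_eq_one_iff_dvd _ |>.2 (Nat.pow_dvd_pow _ (by omega))
    · obtain ⟨j, hj, hjt⟩ := (Nat.dvd_prime_pow hp).1 ((key _ hk t).2 le_rfl)
      have := (key _ hk j).1 (by rw [hjt])
      rw [hjt]; congr 1; omega

lemma cardXX (p r n m s t : ℕ) (hp : p.Prime) (hodd : Odd p) (hs1 : 1 ≤ s) (hsn : s ≤ n - 1)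
    (hord : orderOf ((r : ZMod (p ^ n))) = p ^ s) (ht : 1 ≤ t) (hts : t ≤ s) (hsm : s ≤ m) :
    Nat.card {x : ℂ × ℂ // x.1 ^ (p ^ n) = 1 ∧
      Function.minimalPeriod (fun y : ℂ => y ^ r) x.1 = p ^ t ∧ x.2 ^ (p ^ m / p ^ t) = 1}
      = p ^ t * (Nat.totient (p ^ (n - s)) * p ^ (m - t)) ∧
    Finite {x : ℂ × ℂ // x.1 ^ (p ^ n) = 1 ∧
      Function.minimalPeriod (fun y : ℂ => y ^ r) x.1 = p ^ t ∧ x.2 ^ (p ^ m / p ^ t) = 1} := by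
  let S : Finset (ℂ × ℂ) := primitiveRoots (p ^ (n - s + t)) ℂ ×ˢ
    Polynomial.nthRootsFinset (p ^ (m - t)) (1 : ℂ)
  have hS : ∀ x : ℂ × ℂ, (x.1 ^ (p ^ n) = 1 ∧
      Function.minimalPeriod (fun y : ℂ => y ^ r) x.1 = p ^ t ∧ x.2 ^ (p ^ m / p ^ t) = 1) ↔ x ∈ S := by
    intro x
    rw [Finset.mem_product, mem_primitiveRoots (pow_pos hp.pos _),
      Polynomial.mem_nthRootsFinset (pow_pos hp.pos _), ← and_assoc,
      minperX p r n s t hp hodd hs1 hsn hord ht hts, Nat.pow_div (by omega) hp.pos]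
  have e := Equiv.subtypeEquivRight hS
  refine ⟨?_, Finite.of_equiv _ e.symm⟩
  rw [Nat.card_congr e]
  have hprim := Complex.isPrimitiveRoot_exp (p ^ (m - t)) (pow_pos hp.pos _).ne'
  have : Nat.card {x // x ∈ S} = S.card := by simp
  rw [this, Finset.card_product, Complex.card_primitiveRoots, hprim.card_nthRootsFinset,
    Nat.totient_prime_pow hp (by omega), Nat.totient_prime_pow hp (by omega)]
  have : n - s + t - 1 = t + (n - s - 1) := by omega
  rw [this, pow_add]; ring

lemma countX {G : Type} [Group G] [Finite G] (a c : G) (N M r d : ℕ) (hN : 0 < N) (hM : 0 < M)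
    (hcard : Nat.card G = N * M) (hgen : Subgroup.closure {a, c} = ⊤)
    (ha : a ^ N = 1) (hc : c ^ M = 1) (h : a * c = c * a ^ r) (hdM : d ∣ M) (hd : 0 < d)
    (hX : Finite {x : ℂ × ℂ // x.1 ^ N = 1 ∧
      Function.minimalPeriod (fun y : ℂ => y ^ r) x.1 = d ∧ x.2 ^ (M / d) = 1}) :
    Nat.card {x : ℂ × ℂ // x.1 ^ N = 1 ∧
      Function.minimalPeriod (fun y : ℂ => y ^ r) x.1 = d ∧ x.2 ^ (M / d) = 1} =
      d * Nat.card (Quotient (repIsoSetoid G d)) := by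
  set X := {x : ℂ × ℂ // x.1 ^ N = 1 ∧
      Function.minimalPeriod (fun y : ℂ => y ^ r) x.1 = d ∧ x.2 ^ (M / d) = 1} with hXdef
  have hper : ∀ z : ℂ, Function.minimalPeriod (fun y : ℂ => y ^ r) z = d → z ^ (r ^ d) = z := by
    intro z hz
    rw [← iterX, ← hz]; exact Function.isPeriodicPt_minimalPeriod _ _
  have hinj : ∀ z : ℂ, Function.minimalPeriod (fun y : ℂ => y ^ r) z = d →
      Set.InjOn (fun i : ℕ => z ^ (r ^ i)) (Set.Iio d) := by
    intro z hz
    have := injX r z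
    rwa [hz] at this
  have hmod : ∀ x : X, ∃ V : {V : FDRep ℂ G // Simple V ∧ Module.finrank ℂ V = d},
      OccX a c d V.1 x.1.1 x.1.2 := by
    intro x
    obtain ⟨V, hV, hocc⟩ := modelX a c N M r d hN hM hcard hgen ha hc h hdM hd x.1.1 x.1.2
      x.2.1 (hper _ x.2.2.1) x.2.2.2
    exact ⟨⟨V, simpleX V a c r d h hd hV _ _ (hinj _ x.2.2.1) hocc, hV⟩, hocc⟩
  choose F hF using hmod
  let Q := Quotient (repIsoSetoid G d)
  let F' : X → Q := fun x => Quotient.mk _ (F x)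
  have hF' : ∀ x V, F' x = Quotient.mk _ V ↔ OccX a c d V.1 x.1.1 x.1.2 := by
    intro x V
    constructor
    · intro hq
      obtain ⟨e⟩ := Quotient.exact hq
      exact occ_isoX a c d _ _ e _ _ (hF x)
    · intro ho
      exact Quotient.sound (uniqueX (F x).1 V.1 a c r d h hgen hd (F x).2.2 V.2.2 _ _
        (hinj _ x.2.2.1) (hF x) ho)
  have hfib : ∀ q : Q, Nat.card {x : X // F' x = q} = d := by
    intro q
    induction q using Quotient.inductionOn with
    | h V =>
    obtain ⟨z, l, hzN, hzd, hl, v, hv, hvz, hvl⟩ := existsX V.1 V.2.1 a c N M r d h hM hgen ha hc hdM hd V.2.2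
    have hAC := rho_relX V.1 a c r h
    obtain ⟨b, hb⟩ := basisX V.1 a c r d h hd V.2.2 z (hinj z hzd) v hv hvz
    have hpp : z ∈ Function.periodicPts (fun y : ℂ => y ^ r) :=
      Function.minimalPeriod_pos_iff_mem_periodicPts.1 (by omega)
    have hCd : ∀ j, ((V.1.ρ c) ^ d) (((V.1.ρ c) ^ j) v) = l • ((V.1.ρ c) ^ j) v := by
      intro j
      rw [← Module.End.mul_apply, ← pow_add, add_comm, pow_add, Module.End.mul_apply, hvl, map_smul]
    let g : Fin d → {x : X // F' x = Quotient.mk _ V} := fun j =>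
      ⟨⟨(z ^ (r ^ (j : ℕ)), l), by
        refine ⟨?_, ?_, hl⟩
        · show (z ^ (r ^ (j : ℕ))) ^ N = 1
          rw [← pow_mul, mul_comm, pow_mul, hzN, one_pow]
        · show Function.minimalPeriod (fun y : ℂ => y ^ r) (z ^ (r ^ (j : ℕ))) = d
          rw [← iterX, Function.minimalPeriod_apply_iterate hpp, hzd]⟩,
        (hF' _ _).2 ⟨((V.1.ρ c) ^ (j : ℕ)) v, rho_neX V.1 c v hv j, eigX _ _ r hAC v z hvz j, hCd j⟩⟩
    have hg : Function.Bijective g := by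
      constructor
      · intro i j hij
        have : z ^ (r ^ (i : ℕ)) = z ^ (r ^ (j : ℕ)) := congrArg (fun x => x.1.1.1) hij
        exact Fin.ext (hinj z hzd i.2 j.2 this)
      · rintro ⟨x, hx⟩
        obtain ⟨w, hw, hwz, hwl⟩ := (hF' _ _).1 hx
        obtain ⟨j, hj, k, hk, hwk, hxj⟩ := eigen_formX (V.1.ρ a) (V.1.ρ c) r hAC v z hvz
          (rho_neX V.1 c v hv) d (hinj z hzd) b hb w hw _ hwz
        have hll : x.1.2 = l := by
          have : ((V.1.ρ c) ^ d) w = l • w := by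
            rw [hwk, map_smul, hCd, smul_comm]
          exact smul_left_injective ℂ hw (hwl.symm.trans this)
        refine ⟨⟨j, hj⟩, Subtype.ext (Subtype.ext (Prod.ext hxj.symm hll.symm))⟩
    rw [← Nat.card_congr (Equiv.ofBijective g hg), Nat.card_fin]
  have hsurj : Function.Surjective F' := by
    intro q
    have : 0 < Nat.card {x : X // F' x = q} := by rw [hfib q]; exact hd
    obtain ⟨⟨x, hx⟩⟩ := (Nat.card_pos_iff.1 this).1
    exact ⟨x, hx⟩
  have hQ : Finite Q := Finite.of_surjective F' hsurj
  have := Fintype.ofFinite Q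
  rw [← Nat.card_congr (Equiv.sigmaFiberEquiv F'), Nat.card_sigma]
  simp only [hfib]
  rw [Finset.sum_const, Finset.card_univ, smul_eq_mul, mul_comm, Nat.card_eq_fintype_card]

/-- **Proposition.** Let `p` be an odd prime and let
`G = ⟨a, b | a^(p^n) = b^(p^m) = 1, b a b⁻¹ = a^r⟩` be the split metacyclic
`p`-group, with `n ≥ 2`, `m ≥ 1`, `gcd(r, p^n) = 1`, `r` of multiplicative
order `p^s` modulo `p^n` and `1 ≤ s ≤ min {n-1, m}`.  For each `1 ≤ t ≤ s`,
the number of isomorphism classes of irreducible complex representations of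
`G` of degree `p^t` equals `φ(p^(n-s))·p^(m-t) = (p^(n-s) − p^(n-s-1))·p^(m-t)`. -/
theorem stmt_16 (p n m s : ℕ) (r : ℤ) (hp : p.Prime) (hodd : Odd p)
    (hn : 2 ≤ n) (hm : 1 ≤ m) (hs1 : 1 ≤ s) (hsn : s ≤ n - 1) (hsm : s ≤ m)
    (hr : Int.gcd r (p ^ n) = 1) (hord : orderOf ((r : ZMod (p ^ n))) = p ^ s)
    (G : Type) [Group G] (a b : G)
    (hcard : Nat.card G = p ^ (n + m))
    (ha : orderOf a = p ^ n) (hb : orderOf b = p ^ m)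
    (hrel : b * a * b⁻¹ = a ^ r)
    (hgen : Subgroup.closure {a, b} = ⊤) :
    ∀ t : ℕ, 1 ≤ t → t ≤ s →
      Nat.card (Quotient (repIsoSetoid G (p ^ t)))
          = Nat.totient (p ^ (n - s)) * p ^ (m - t) ∧
        Nat.totient (p ^ (n - s)) * p ^ (m - t)
          = (p ^ (n - s) - p ^ (n - s - 1)) * p ^ (m - t) := by
  intro t ht hts
  have hpos : ∀ k, 0 < p ^ k := fun k => pow_pos hp.pos k
  constructor
  · have : NeZero (p ^ n) := ⟨(hpos n).ne'⟩
    set r0 : ℕ := (r : ZMod (p ^ n)).val with hr0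
    have hr0c : ((r0 : ℕ) : ZMod (p ^ n)) = (r : ZMod (p ^ n)) := ZMod.natCast_zmod_val _
    rw [← hr0c] at hord
    have har : a ^ r = a ^ r0 := by
      rw [← zpow_natCast, hr0, ZMod.val_intCast, ← ha, zpow_mod_orderOf]
    have hfin : Finite G := Nat.finite_of_card_ne_zero (by rw [hcard]; exact (hpos _).ne')
    have hgen' : Subgroup.closure {a, b⁻¹} = ⊤ := by
      rw [eq_top_iff, ← hgen, Subgroup.closure_le]
      rintro u (rfl | rfl)
      · exact Subgroup.subset_closure (by simp)
      · have : u⁻¹ ∈ Subgroup.closure {a, u⁻¹} := Subgroup.subset_closure (by simp)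
        simpa using inv_mem this
    have hrel' : a * b⁻¹ = b⁻¹ * a ^ r0 := by
      rw [← har, ← hrel]; group
    obtain ⟨h1, h2⟩ := cardXX p r0 n m s t hp hodd hs1 hsn hord ht hts hsm
    have h3 := countX a b⁻¹ (p ^ n) (p ^ m) r0 (p ^ t) (hpos _) (hpos _) (by rw [hcard, pow_add])
      hgen' (by rw [← ha, pow_orderOf_eq_one]) (by rw [inv_pow, ← hb, pow_orderOf_eq_one, inv_one])
      hrel' (Nat.pow_dvd_pow _ (by omega)) (hpos _) h2
    exact Nat.eq_of_mul_eq_mul_left (hpos t) (h3.symm.trans h1)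
  · congr 1
    rw [Nat.totient_prime_pow hp (by omega), Nat.mul_sub, mul_one, ← pow_succ,
      Nat.sub_add_cancel (by omega)]
end

section
/- Let p be an odd prime, let M, S be natural numbers with 0 ≤ S < M, and let k be an integer with 1 ≤ k < p^S and gcd(k, p) = 1. If ζ ∈ ℂ is a primitive p^M-th root of unity, then Σ_{i=0}^{p^S − 1} ζ^{(1 + k·p^{M−S})^i} = 0. -/
theorem aux_inj (p M S k n : ℕ) (hp : p.Prime) (hodd : Odd p) (hSM : S < M)
    (hk1 : 1 ≤ k) (hkp : Nat.Coprime k p) (hn : n ≠ 0) (hlt : n < p ^ S)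
    (h : p ^ M ∣ (1 + k * p ^ (M - S)) ^ n - 1) : False := by
  haveI : Fact p.Prime := ⟨hp⟩
  have hq : 0 < p ^ (M - S) := pow_pos hp.pos _
  have hkq : 0 < k * p ^ (M - S) := Nat.mul_pos hk1 hq
  have hpd : p ∣ k * p ^ (M - S) := Dvd.dvd.mul_left (dvd_pow_self p (by omega)) k
  have hx : ¬ p ∣ 1 + k * p ^ (M - S) := by
    intro h1
    exact hp.one_lt.ne' (Nat.dvd_one.1 ((Nat.dvd_add_left hpd).1 h1))
  have key := padicValNat.pow_sub_pow (p := p) (x := 1 + k * p ^ (M - S)) (y := 1) hodd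
    (by omega) (by simpa using hpd) hx hn
  have hkv : padicValNat p k = 0 := by
    apply padicValNat.eq_zero_of_not_dvd
    intro h2
    exact (Nat.Prime.coprime_iff_not_dvd hp).1 hkp.symm h2
  rw [one_pow, Nat.add_sub_cancel_left, padicValNat.mul (by omega) hq.ne', hkv,
    padicValNat.prime_pow] at key
  have hne : (1 + k * p ^ (M - S)) ^ n - 1 ≠ 0 := by
    have : 1 < (1 + k * p ^ (M - S)) ^ n := Nat.one_lt_pow hn (by omega)
    omega
  have h3 := (padicValNat_dvd_iff_le hne).1 h
  have h4 : p ^ S ∣ n := (padicValNat_dvd_iff_le hn).2 (by omega)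
  exact absurd (Nat.le_of_dvd (by omega) h4) (by omega)

theorem aux_inj2 (p M S k i j : ℕ) (hp : p.Prime) (hodd : Odd p) (hSM : S < M)
    (hk1 : 1 ≤ k) (hkp : Nat.Coprime k p) (hlt : j < p ^ S) (hij : i < j)
    (h : (1 + k * p ^ (M - S)) ^ i ≡ (1 + k * p ^ (M - S)) ^ j [MOD p ^ M]) : False := by
  have hpd : p ∣ k * p ^ (M - S) := Dvd.dvd.mul_left (dvd_pow_self p (by omega)) k
  have hx : ¬ p ∣ 1 + k * p ^ (M - S) := by
    intro h1
    exact hp.one_lt.ne' (Nat.dvd_one.1 ((Nat.dvd_add_left hpd).1 h1))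
  have hc : Nat.Coprime (p ^ M) ((1 + k * p ^ (M - S)) ^ i) :=
    Nat.Coprime.pow _ _ ((Nat.Prime.coprime_iff_not_dvd hp).2 hx)
  apply aux_inj p M S k (j - i) hp hodd hSM hk1 hkp (by omega) (by omega)
  have h5 := (Nat.modEq_iff_dvd' (Nat.pow_le_pow_right (by omega) hij.le)).1 h
  apply hc.dvd_of_dvd_mul_left
  rwa [Nat.mul_sub, mul_one, ← pow_add, Nat.add_sub_cancel' hij.le]

/-- **Lemma (vanishing sum of roots of unity).** Let `p` be an odd prime,
`S < M` naturals, `k` an integer with `1 ≤ k < p^S` coprime to `p`, and `ζ ∈ ℂ`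
a primitive `p^M`-th root of unity. Then `∑_{i=0}^{p^S−1} ζ^((1+k·p^(M−S))^i) = 0`. -/
theorem stmt_17 (p M S k : ℕ) (hp : p.Prime) (hodd : Odd p) (hSM : S < M)
    (hk1 : 1 ≤ k) (hk2 : k < p ^ S) (hkp : Nat.Coprime k p)
    (ζ : ℂ) (hζ : IsPrimitiveRoot ζ (p ^ M)) :
    ∑ i ∈ Finset.range (p ^ S), ζ ^ ((1 + k * p ^ (M - S)) ^ i) = 0 := by
  have hpM : p ^ M = p ^ (M - S) * p ^ S := by rw [← pow_add]; congr 1; omega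
  have hη : IsPrimitiveRoot (ζ ^ (p ^ (M - S))) (p ^ S) :=
    hζ.pow (pow_pos hp.pos _) hpM
  have ha : ∀ i, ∃ a, (1 + k * p ^ (M - S)) ^ i = 1 + p ^ (M - S) * a := by
    intro i
    have h1 : p ^ (M - S) ∣ (1 + k * p ^ (M - S)) ^ i - 1 := by
      have := Nat.sub_dvd_pow_sub_pow (1 + k * p ^ (M - S)) 1 i
      rw [one_pow, Nat.add_sub_cancel_left] at this
      exact (Dvd.intro_left k rfl).trans this
    obtain ⟨a, h2⟩ := h1
    have : 0 < (1 + k * p ^ (M - S)) ^ i := by positivity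
    exact ⟨a, by omega⟩
  choose a ha using ha
  have hpS : 0 < p ^ S := pow_pos hp.pos _
  have hinj : Set.InjOn (fun i => a i % p ^ S) (Finset.range (p ^ S)) := by
    intro i hi j hj hij
    simp only [Finset.coe_range, Set.mem_Iio] at hi hj
    have h6 : a i ≡ a j [MOD p ^ S] := hij
    have h7 : (1 + k * p ^ (M - S)) ^ i ≡ (1 + k * p ^ (M - S)) ^ j [MOD p ^ M] := by
      rw [ha, ha, hpM]
      exact (Nat.ModEq.mul_left' _ h6).add_left 1
    rcases lt_trichotomy i j with h | h | h
    · exact (aux_inj2 p M S k i j hp hodd hSM hk1 hkp hj h h7).elim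
    · exact h
    · exact (aux_inj2 p M S k j i hp hodd hSM hk1 hkp hi h h7.symm).elim
  have himg : (Finset.range (p ^ S)).image (fun i => a i % p ^ S) = Finset.range (p ^ S) := by
    apply Finset.eq_of_subset_of_card_le
    · intro x hx
      obtain ⟨i, -, rfl⟩ := Finset.mem_image.1 hx
      exact Finset.mem_range.2 (Nat.mod_lt _ hpS)
    · rw [Finset.card_image_of_injOn hinj]
  have hg := hη.geom_sum_eq_zero (by omega)
  rw [← himg, Finset.sum_image hinj] at hg
  calc _ = ∑ i ∈ Finset.range (p ^ S), ζ * (ζ ^ (p ^ (M - S))) ^ (a i % p ^ S) := by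
        refine Finset.sum_congr rfl fun i _ => ?_
        rw [ha, pow_add, pow_one, pow_mul, ← pow_mod_orderOf, ← hη.eq_orderOf]
    _ = 0 := by rw [← Finset.mul_sum, hg, mul_zero]
end

section
/- Let p be an odd prime and let n, m ≥ 1 be integers. Let T and T' be two group homomorphisms from the cyclic group C_{p^m} of order p^m to the automorphism group Aut(C_{p^n}) of the cyclic group C_{p^n} of order p^n, and suppose the images of T and T' have the same cardinality. Then the semidirect products C_{p^n} ⋊_T C_{p^m} and C_{p^n} ⋊_{T'} C_{p^m} are isomorphic as groups. -/
theorem aux_mem {G : Type*} [Group G] [Finite G] [IsCyclic G] (a b : G)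
    (h : orderOf a = orderOf b) : a ∈ Subgroup.zpowers b := by
  classical
  have := Fintype.ofFinite G
  have hd : 0 < orderOf b := orderOf_pos b
  have h1 := IsCyclic.card_pow_eq_one_le (α := G) hd
  have hsub : (Subgroup.zpowers b : Set G).toFinset ⊆
      Finset.univ.filter (fun x : G => x ^ orderOf b = 1) := by
    intro x hx
    simp only [Set.mem_toFinset, SetLike.mem_coe] at hx
    obtain ⟨k, rfl⟩ := hx
    simp only [Finset.mem_filter, Finset.mem_univ, true_and]
    rw [← zpow_natCast, zpow_comm, zpow_natCast, pow_orderOf_eq_one, one_zpow]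
  have hc : (Subgroup.zpowers b : Set G).toFinset.card = orderOf b := by
    rw [← Nat.card_zpowers, Set.toFinset_card, ← Nat.card_eq_fintype_card]
    rfl
  have he := Finset.eq_of_subset_of_card_le hsub (by rw [hc]; exact h1)
  have ha : a ∈ Finset.univ.filter (fun x : G => x ^ orderOf b = 1) := by
    simp [← h, pow_orderOf_eq_one]
  rw [← he] at ha
  simpa using ha

theorem aux_gen {C A : Type*} [CommGroup C] [Finite C] [IsCyclic C] [Group A] [Finite A]
    [IsCyclic A] (p m : ℕ) (hp : p.Prime) (hC : Nat.card C = p ^ m) (T T' : C →* A)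
    (h : Nat.card T.range = Nat.card T'.range) :
    ∃ k : ℕ, (Nat.card C).Coprime k ∧ ∀ x, T x = T' (x ^ k) := by
  obtain ⟨g, hg⟩ := IsCyclic.exists_generator (α := C)
  have hr : ∀ S : C →* A, Nat.card S.range = orderOf (S g) := by
    intro S
    rw [← Nat.card_zpowers, ← MonoidHom.map_zpowers, (Subgroup.eq_top_iff' _).2 hg,
      ← MonoidHom.range_eq_map]
  rw [hr, hr] at h
  have red : ∀ k : ℕ, T g = T' g ^ k → ∀ x, T x = T' (x ^ k) := by
    intro k hk x
    obtain ⟨j, rfl⟩ := hg x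
    simp only [map_zpow, map_pow, hk]
    rw [← zpow_natCast, ← zpow_natCast, zpow_comm]
  obtain ⟨k, hk⟩ := (mem_powers_iff_mem_zpowers.2 (aux_mem _ _ h) : T g ∈ Submonoid.powers (T' g))
  have hk : T g = T' g ^ k := hk.symm
  by_cases h1 : orderOf (T' g) = 1
  · refine ⟨1, by simp, red 1 ?_⟩
    rw [h1] at h
    rw [orderOf_eq_one_iff.1 h, orderOf_eq_one_iff.1 h1, one_pow]
  · refine ⟨k, ?_, red k hk⟩
    have hd : orderOf (T' g) ∣ p ^ m := by
      rw [← hC]; exact (orderOf_map_dvd T' g).trans (orderOf_dvd_natCard g)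
    obtain ⟨j, -, hj⟩ := (Nat.dvd_prime_pow hp).1 hd
    have hj0 : j ≠ 0 := by rintro rfl; simp [hj] at h1
    have hpos : 0 < orderOf (T' g) := orderOf_pos _
    rw [hk, orderOf_pow] at h
    have hg1 : (orderOf (T' g)).gcd k = 1 := by
      rcases (Nat.div_eq_self.1 h) with h0 | h0
      · omega
      · exact h0
    rw [hC]
    refine Nat.Coprime.pow_left m ?_
    have h2 : Nat.Coprime (p ^ j) k := by rw [← hj]; exact hg1
    exact (Nat.coprime_pow_left_iff (Nat.pos_of_ne_zero hj0) _ _).1 h2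


/-- **Remark.** Let `p` be an odd prime and `n, m ≥ 1`. If two homomorphisms
`T, T' : C_{p^m} → Aut(C_{p^n})` have images of the same cardinality, then the
semidirect products `C_{p^n} ⋊_T C_{p^m}` and `C_{p^n} ⋊_{T'} C_{p^m}` are
isomorphic. -/
theorem stmt_18 (p n m : ℕ) (hp : p.Prime) (hodd : Odd p) (hn : 1 ≤ n) (hm : 1 ≤ m)
    (T T' : Multiplicative (ZMod (p ^ m)) →* MulAut (Multiplicative (ZMod (p ^ n))))
    (h : Nat.card T.range = Nat.card T'.range) :
    Nonempty
      ((Multiplicative (ZMod (p ^ n)) ⋊[T] Multiplicative (ZMod (p ^ m))) ≃*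
       (Multiplicative (ZMod (p ^ n)) ⋊[T'] Multiplicative (ZMod (p ^ m)))) := by
  have : NeZero (p ^ m) := ⟨(pow_pos hp.pos m).ne'⟩
  have : NeZero (p ^ n) := ⟨(pow_pos hp.pos n).ne'⟩
  have hC : Nat.card (Multiplicative (ZMod (p ^ m))) = p ^ m := by simp
  have hN : Nat.card (Multiplicative (ZMod (p ^ n))) = p ^ n := by simp
  have hp2 : p ≠ 2 := by rintro rfl; exact absurd hodd (by decide)
  have hcyc : IsCyclic (ZMod (Nat.card (Multiplicative (ZMod (p ^ n)))))ˣ := by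
    rw [hN]; exact ZMod.isCyclic_units_of_prime_pow p hp hp2 n
  have hA : IsCyclic (MulAut (Multiplicative (ZMod (p ^ n)))) :=
    (IsCyclic.mulAutMulEquiv (Multiplicative (ZMod (p ^ n)))).isCyclic.2 hcyc
  have hF : Finite (MulAut (Multiplicative (ZMod (p ^ n)))) :=
    Finite.of_injective _ (DFunLike.coe_injective)
  obtain ⟨k, hk, hT⟩ := aux_gen p m hp hC T T' h
  refine ⟨SemidirectProduct.congr (MulEquiv.refl _)
    (MulEquiv.ofBijective (powMonoidHom k) hk.pow_left_bijective) ?_⟩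
  intro g
  rw [hT g]
  rfl
end

section
/- Let p be an odd prime and let G be the split metacyclic p-group G = ⟨a, b | a^(p^n) = b^(p^m) = 1, b a b⁻¹ = a^r⟩ with n ≥ 2, m ≥ 1, gcd(r, p^n) = 1 and r of multiplicative order p^s modulo p^n, 1 ≤ s ≤ min{n−1, m}. Suppose n − s ≥ m. Then for each t with 1 ≤ t ≤ s, the number of Galois conjugacy classes of irreducible complex characters of G of degree p^t is exactly p^{m−t}, and every such class has cardinality φ(p^{n−s}). -/
open CategoryTheory

theorem galois_ext0 (N : ℕ) [NeZero N] (K : Type) [Field K] [Algebra ℚ K] [IsCyclotomicExtension {N} ℚ K] (z w : ℂ) (hz : IsPrimitiveRoot z N) (hw : IsPrimitiveRoot w N) :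
    ∃ σ : ℂ ≃+* ℂ, σ z = w := by
  have : Algebra.IsAlgebraic ℚ K := 
    (IsCyclotomicExtension.integral {N} ℚ K).isAlgebraic
  let i : K →ₐ[ℚ] ℂ := IsAlgClosed.lift
  let : Algebra K ℂ := i.toRingHom.toAlgebra
  have hi : ∀ x, algebraMap K ℂ x = i x := fun _ => rfl
  have key : ∀ u : ℂ, IsPrimitiveRoot u N → ∃ x : K, i x = u ∧ IsPrimitiveRoot x N := by
    intro u hu
    have h0 : IsPrimitiveRoot (i (IsCyclotomicExtension.zeta N ℚ K)) N :=
      (IsCyclotomicExtension.zeta_spec N ℚ K).map_of_injective i.toRingHom.injective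
    obtain ⟨k, hk, hk'⟩ := h0.eq_pow_of_pow_eq_one hu.pow_eq_one
    refine ⟨IsCyclotomicExtension.zeta N ℚ K ^ k, by rw [map_pow, hk'], ?_⟩
    refine IsPrimitiveRoot.of_map_of_injective (f := i) ?_ i.toRingHom.injective
    rw [map_pow, hk']; exact hu
  have irr := Polynomial.cyclotomic.irreducible_rat (NeZero.pos N)
  have key2 : ∀ u : ℂ, IsPrimitiveRoot u N → ∃ σ : ℂ ≃+* ℂ, σ (i (IsCyclotomicExtension.zeta N ℚ K)) = u := by
    intro u hu
    obtain ⟨x, hx, hxp⟩ := key u hu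
    let τ := (IsCyclotomicExtension.fromZetaAut hxp irr)
    have hτ : τ (IsCyclotomicExtension.zeta N ℚ K) = x := IsCyclotomicExtension.fromZetaAut_spec hxp irr
    obtain ⟨s, hs⟩ := exists_isTranscendenceBasis K ℂ
    let := IsAlgClosed.isAlgClosure_of_transcendence_basis _ hs
    let e : Algebra.adjoin K (Set.range ((↑) : s → ℂ)) ≃+* Algebra.adjoin K (Set.range ((↑) : s → ℂ)) :=
      (hs.1.aevalEquiv.symm.toRingEquiv.trans (MvPolynomial.mapEquiv _ τ.toRingEquiv)).trans hs.1.aevalEquiv.toRingEquiv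
    refine ⟨IsAlgClosure.equivOfEquiv ℂ ℂ e, ?_⟩
    have h1 := IsAlgClosure.equivOfEquiv_algebraMap ℂ ℂ e (algebraMap K _ (IsCyclotomicExtension.zeta N ℚ K))
    have h2 : e (algebraMap K _ (IsCyclotomicExtension.zeta N ℚ K)) = algebraMap K _ x := by
      simp only [e, RingEquiv.trans_apply]
      have : hs.1.aevalEquiv.symm.toRingEquiv (algebraMap K _ (IsCyclotomicExtension.zeta N ℚ K)) = MvPolynomial.C (IsCyclotomicExtension.zeta N ℚ K) :=
        hs.1.aevalEquiv.symm.commutes _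
      rw [this]
      have : (MvPolynomial.mapEquiv s τ.toRingEquiv) (MvPolynomial.C (IsCyclotomicExtension.zeta N ℚ K)) = MvPolynomial.C x := by
        rw [← hτ]; exact MvPolynomial.map_C _ _
      rw [this]
      exact hs.1.aevalEquiv.commutes _
    rw [h2, ← IsScalarTower.algebraMap_apply, ← IsScalarTower.algebraMap_apply, hi, hi, hx] at h1
    exact h1
  obtain ⟨σ, hσ⟩ := key2 z hz
  obtain ⟨σ', hσ'⟩ := key2 w hw
  exact ⟨σ.symm.trans σ', by rw [← hσ]; simp [hσ']⟩

theorem galois_ext (N : ℕ) [NeZero N] (z w : ℂ) (hz : IsPrimitiveRoot z N) (hw : IsPrimitiveRoot w N) :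
    ∃ σ : ℂ ≃+* ℂ, σ z = w :=

  @galois_ext0 N _ (CyclotomicField N ℚ) _ (CyclotomicField.algebra N ℚ) inferInstance z w hz hw

theorem lte_r (p n s : ℕ) (r : ℤ) (hp : p.Prime) (hodd : Odd p) (hs1 : 1 ≤ s) (hsn : s ≤ n - 1)
    (hord : orderOf ((r : ZMod (p ^ n))) = p ^ s) :
    ∃ c : ℤ, r = 1 + p ^ (n - s) * c ∧ ¬ (p : ℤ) ∣ c := by
  have := Fact.mk hp
  have hdvd : ∀ k : ℕ, (p ^ n : ℤ) ∣ r ^ k - 1 ↔ p ^ s ∣ k := by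
    intro k
    rw [← hord, orderOf_dvd_iff_pow_eq_one]
    rw [show (p ^ n : ℤ) = ((p ^ n : ℕ) : ℤ) by push_cast; rfl, ← ZMod.intCast_zmod_eq_zero_iff_dvd]
    push_cast
    exact sub_eq_zero
  have h1 : (p ^ n : ℤ) ∣ r ^ (p ^ s) - 1 := (hdvd _).2 dvd_rfl
  have h2 : ¬ (p ^ n : ℤ) ∣ r ^ (p ^ (s - 1)) - 1 := by
    rw [hdvd]; intro h
    have := Nat.le_of_dvd (pow_pos hp.pos _) h
    have := (Nat.pow_le_pow_iff_right hp.one_lt).1 this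
    omega
  have hpr : (p : ℤ) ∣ r - 1 := by
    have : (p : ℤ) ∣ r ^ (p ^ s) - 1 := (dvd_pow_self (p : ℤ) (by omega)).trans h1
    rw [← ZMod.intCast_zmod_eq_zero_iff_dvd] at this ⊢
    push_cast at this ⊢
    rwa [ZMod.pow_card_pow] at this
  have hpr' : ¬ (p : ℤ) ∣ r := fun h => by
    have : (p : ℤ) ∣ 1 := by simpa using dvd_sub h hpr
    have := Int.eq_one_of_dvd_one (by positivity) this
    have := hp.one_lt
    omega
  have L : ∀ k : ℕ, emultiplicity (p : ℤ) (r ^ (p ^ k) - 1) = emultiplicity (p : ℤ) (r - 1) + k := by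
    intro k
    have := Int.emultiplicity_pow_sub_pow hp hodd (x := r) (y := 1) hpr hpr' (p ^ k)
    rw [one_pow] at this
    rw [this, (Nat.finiteMultiplicity_iff.2 ⟨hp.ne_one, pow_pos hp.pos _⟩ : FiniteMultiplicity p (p^k)).emultiplicity_eq_multiplicity]
    congr 2
    exact multiplicity_pow_self_of_prime hp.prime k
  rw [pow_dvd_iff_le_emultiplicity, L] at h1 h2
  have hfin : FiniteMultiplicity (p : ℤ) (r - 1) := by
    by_contra h
    rw [← emultiplicity_eq_top] at h
    rw [h] at h2; simp at h2
  rw [hfin.emultiplicity_eq_multiplicity] at h1 h2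
  norm_cast at h1 h2
  have hv : multiplicity (p : ℤ) (r - 1) = n - s := by omega
  obtain ⟨c, hc, hc'⟩ := hfin.exists_eq_pow_mul_and_not_dvd
  rw [hv] at hc
  exact ⟨c, by linarith, hc'⟩

theorem nf {H : Type*} [Group H] (a b : H) (N M : ℕ) (hN : 0 < N) (hM : 0 < M) (r : ℤ)
    (ha : a ^ N = 1) (hb : b ^ M = 1) (hrel : b * a * b⁻¹ = a ^ r) (g : H)
    (hg : g ∈ Subgroup.closure {a, b}) : ∃ i < N, ∃ j < M, g = a ^ i * b ^ j := by
  have hz : ∀ z : ℤ, ∃ i : ℕ, a ^ z = a ^ i := by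
    intro z
    refine ⟨(z % N).toNat, ?_⟩
    have h0 : 0 ≤ z % N := Int.emod_nonneg _ (by omega)
    conv_lhs => rw [← Int.emod_add_mul_ediv z N, zpow_add, zpow_mul, zpow_natCast, ha, one_zpow, mul_one]
    rw [← zpow_natCast, Int.toNat_of_nonneg h0]
  have hba : ∀ i : ℕ, b * a ^ i = a ^ (r * i) * b := by
    intro i
    rw [zpow_mul, ← hrel, zpow_natCast, conj_pow]; group
  let P : H → Prop := fun g => ∃ i j : ℕ, g = a ^ i * b ^ j
  have hPa : ∀ g, P g → P (a * g) := by
    rintro _ ⟨i, j, rfl⟩; exact ⟨i + 1, j, by rw [pow_succ' a i, mul_assoc]⟩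
  have hPb : ∀ g, P g → P (b * g) := by
    rintro _ ⟨i, j, rfl⟩
    obtain ⟨k, hk⟩ := hz (r * i)
    exact ⟨k, j + 1, by rw [← mul_assoc, hba, hk, mul_assoc, ← pow_succ']⟩
  have hpow : ∀ x : H, (∀ g, P g → P (x * g)) → ∀ k : ℕ, ∀ g, P g → P (x ^ k * g) := by
    intro x hx k
    induction k with
    | zero => intro g hg; simpa using hg
    | succ k ih => intro g hg; rw [pow_succ', mul_assoc]; exact hx _ (ih _ hg)
  have hai : a⁻¹ = a ^ (N - 1) := by
    rw [inv_eq_iff_mul_eq_one, ← pow_succ', Nat.sub_add_cancel hN, ha]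
  have hbi : b⁻¹ = b ^ (M - 1) := by
    rw [inv_eq_iff_mul_eq_one, ← pow_succ', Nat.sub_add_cancel hM, hb]
  have : P g := by
    induction hg using Subgroup.closure_induction_left with
    | one => exact ⟨0, 0, by simp⟩
    | mul_left x hx y hy ih =>
      rcases hx with rfl | rfl
      · exact hPa _ ih
      · exact hPb _ ih
    | inv_mul_cancel x hx y hy ih =>
      rcases hx with rfl | rfl
      · rw [hai]; exact hpow _ hPa _ _ ih
      · rw [hbi]; exact hpow _ hPb _ _ ih
  obtain ⟨i, j, rfl⟩ := this
  refine ⟨i % N, Nat.mod_lt _ hN, j % M, Nat.mod_lt _ hM, ?_⟩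
  rw [← pow_eq_pow_mod _ ha, ← pow_eq_pow_mod _ hb]

theorem nf_bij {G : Type*} [Group G] (a b : G) (N M : ℕ) (hN : 0 < N) (hM : 0 < M) (r : ℤ)
    (ha : a ^ N = 1) (hb : b ^ M = 1) (hrel : b * a * b⁻¹ = a ^ r)
    (hgen : Subgroup.closure {a, b} = ⊤) (hcard : Nat.card G = N * M) :
    Function.Bijective (fun x : Fin N × Fin M => a ^ (x.1 : ℕ) * b ^ (x.2 : ℕ)) := by
  have hfin : Finite G := Nat.finite_of_card_ne_zero (by rw [hcard]; positivity)
  refine Function.Surjective.bijective_of_nat_card_le ?_ ?_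
  · intro g
    obtain ⟨i, hi, j, hj, h⟩ := nf a b N M hN hM r ha hb hrel g (by rw [hgen]; trivial)
    exact ⟨(⟨i, hi⟩, ⟨j, hj⟩), h.symm⟩
  · simp [hcard]

theorem exists_hom {G L : Type*} [Group G] [Group L] (a b : G) (N M : ℕ) (hN : 0 < N) (hM : 0 < M)
    (r : ℤ) (ha : a ^ N = 1) (hb : b ^ M = 1) (hrel : b * a * b⁻¹ = a ^ r)
    (hgen : Subgroup.closure {a, b} = ⊤) (hcard : Nat.card G = N * M)
    (A B : L) (hA : A ^ N = 1) (hB : B ^ M = 1) (hrel' : B * A * B⁻¹ = A ^ r) :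
    ∃ f : G →* L, f a = A ∧ f b = B := by
  have hbij := nf_bij a b N M hN hM r ha hb hrel hgen hcard
  let K : Subgroup (G × L) := Subgroup.closure {(a, A), (b, B)}
  have haK : (a, A) ∈ K := Subgroup.subset_closure (by simp)
  have hbK : (b, B) ∈ K := Subgroup.subset_closure (by simp)
  have hex : ∀ g, ∃ x, (g, x) ∈ K := by
    intro g
    obtain ⟨⟨i, j⟩, rfl⟩ := hbij.2 g
    exact ⟨A ^ (i : ℕ) * B ^ (j : ℕ), K.mul_mem (K.pow_mem haK i) (K.pow_mem hbK j)⟩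
  have hun : ∀ g x y, (g, x) ∈ K → (g, y) ∈ K → x = y := by
    have h : ∀ z ∈ K, _ := nf (a, A) (b, B) N M hN hM r (by simp [ha, hA]) (by simp [hb, hB])
      (by simp [hrel, hrel'])
    intro g x y hx hy
    obtain ⟨i, hi, j, hj, h1⟩ := h _ hx
    obtain ⟨i', hi', j', hj', h2⟩ := h _ hy
    simp only [Prod.pow_mk, Prod.mk_mul_mk, Prod.mk.injEq] at h1 h2
    have := @hbij.1 (⟨i, hi⟩, ⟨j, hj⟩) (⟨i', hi'⟩, ⟨j', hj'⟩) (h1.1.symm.trans h2.1)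
    simp only [Prod.mk.injEq, Fin.mk.injEq] at this
    rw [h1.2, h2.2, this.1, this.2]
  choose f hf using hex
  refine ⟨MonoidHom.mk' f fun g h => hun _ _ _ (hf _) (K.mul_mem (hf g) (hf h)), ?_, ?_⟩
  · exact hun _ _ _ (hf _) haK
  · exact hun _ _ _ (hf _) hbK

theorem q_comm_pow {R : Type*} [Ring R] [Algebra ℂ R] (A B : R) (ε : ℂ) (h : B * A = ε • (A * B)) (i : ℕ) :
    B * A ^ i = ε ^ i • (A ^ i * B) := by
  induction i with
  | zero => simp
  | succ i ih =>
    rw [pow_succ A, ← mul_assoc, ih, smul_mul_assoc, mul_assoc, h, mul_smul_comm, smul_smul, mul_assoc, pow_succ ε]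

theorem q_comm_pow' {R : Type*} [Ring R] [Algebra ℂ R] (A B : R) (ε : ℂ) (h : B * A = ε • (A * B)) (j : ℕ) :
    B ^ j * A = ε ^ j • (A * B ^ j) := by
  induction j with
  | zero => simp
  | succ i ih =>
    rw [pow_succ' B, mul_assoc, ih, mul_smul_comm, ← mul_assoc, h, smul_mul_assoc, smul_smul, mul_assoc, pow_succ ε]

theorem tr_formula {V : Type*} [AddCommGroup V] [Module ℂ V] [FiniteDimensional ℂ V]
    (A B : Module.End ℂ V) (hA : IsUnit A) (hB : IsUnit B) (q : ℕ) (hq : 0 < q) (ζ ω ε : ℂ)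
    (hε : IsPrimitiveRoot ε q) (hAq : A ^ q = ζ • 1) (hBq : B ^ q = ω • 1)
    (hBA : B * A = ε • (A * B)) (i j : ℕ) :
    LinearMap.trace ℂ V (A ^ i * B ^ j) =
      if q ∣ i ∧ q ∣ j then (Module.finrank ℂ V : ℂ) * (ζ ^ (i / q) * ω ^ (j / q)) else 0 := by
  have key : ∀ (X Y : Module.End ℂ V) (c : ℂ), IsUnit X → X * Y = c • (Y * X) → c ≠ 1 →
      LinearMap.trace ℂ V Y = 0 := by
    rintro X Y c ⟨u, rfl⟩ h hc
    have h1 : LinearMap.trace ℂ V ((u : Module.End ℂ V) * Y * (↑u⁻¹ : Module.End ℂ V)) = LinearMap.trace ℂ V Y := by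
      rw [LinearMap.trace_mul_comm, ← mul_assoc, Units.inv_mul, one_mul]
    rw [h, smul_mul_assoc, mul_assoc, Units.mul_inv, mul_one, map_smul, smul_eq_mul] at h1
    have : (c - 1) * LinearMap.trace ℂ V Y = 0 := by rw [sub_mul, h1]; ring
    exact (mul_eq_zero.1 this).resolve_left (sub_ne_zero.2 hc)
  split_ifs with h
  · obtain ⟨⟨i, rfl⟩, ⟨j, rfl⟩⟩ := h
    rw [pow_mul, pow_mul, hAq, hBq, Nat.mul_div_cancel_left _ hq, Nat.mul_div_cancel_left _ hq]
    simp only [smul_pow, one_pow, mul_smul_comm, mul_one, smul_smul, map_smul, LinearMap.trace_one,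
      smul_eq_mul]
    ring
  · rw [not_and_or] at h
    rcases h with h | h
    · refine key B _ (ε ^ i) hB ?_ ?_
      · rw [← mul_assoc, q_comm_pow A B ε hBA, smul_mul_assoc, mul_assoc, mul_assoc, ← pow_succ, ← pow_succ']
      · rwa [Ne, hε.pow_eq_one_iff_dvd]
    · have hne : ε ^ j ≠ 1 := by rwa [Ne, hε.pow_eq_one_iff_dvd]
      have he0 : ε ≠ 0 := hε.ne_zero hq.ne'
      refine key A _ ((ε ^ j)⁻¹) hA ?_ (by simpa using hne)
      rw [mul_assoc, q_comm_pow' A B ε hBA, mul_smul_comm, smul_smul, inv_mul_cancel₀ (pow_ne_zero _ he0), one_smul,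
        ← mul_assoc, ← mul_assoc, ← pow_succ, ← pow_succ']

theorem schur {G : Type} [Group G] (V : FDRep ℂ G) [Simple V] (f : Module.End ℂ V)
    (h : ∀ g, f * V.ρ g = V.ρ g * f) : ∃ c : ℂ, f = c • 1 := by
  let F : V ⟶ V := ⟨InducedCategory.homMk (ModuleCat.ofHom f), fun g => by
    ext x
    exact congrArg (fun k : Module.End ℂ V => k x) (h g)⟩
  obtain ⟨c, hc⟩ := endomorphism_simple_eq_smul_id ℂ F
  refine ⟨c, ?_⟩
  have := congrArg (fun k : V ⟶ V => k.hom.hom.hom) hc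
  exact this.symm

theorem sum_dvd (q K : ℕ) (hq : 0 < q) : ∑ i : Fin (q * K), (if q ∣ (i : ℕ) then (1 : ℂ) else 0) = K := by
  rw [Fin.sum_univ_eq_sum_range (fun i => if q ∣ i then (1 : ℂ) else 0)]
  rw [Finset.sum_boole]
  congr 1
  have := Nat.count_modEq_card (q * K) hq 0
  rw [Nat.count_eq_card_filter_range] at this
  simpa [Nat.modEq_zero_iff_dvd, hq] using this

theorem norm_sum {G : Type} [Group G] [Fintype G] (a b : G) (N M q N' M' : ℕ) (hq : 0 < q)
    (hN : N = q * N') (hM : M = q * M')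
    (hbij : Function.Bijective (fun x : Fin N × Fin M => a ^ (x.1 : ℕ) * b ^ (x.2 : ℕ)))
    (V : FDRep ℂ G) (ζ ω ε : ℂ)
    (hε : IsPrimitiveRoot ε q) (hAq : V.ρ a ^ q = ζ • 1) (hBq : V.ρ b ^ q = ω • 1)
    (hBA : V.ρ b * V.ρ a = ε • (V.ρ a * V.ρ b)) :
    ∑ g : G, V.character g * V.character g⁻¹ = (Module.finrank ℂ V : ℂ) ^ 2 * (N' * M') := by
  have hu : ∀ g, IsUnit (V.ρ g) := fun g => (Group.isUnit g).map V.ρ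
  rw [← (Equiv.ofBijective _ hbij).sum_comp]
  have : ∀ x : Fin N × Fin M, V.character (Equiv.ofBijective _ hbij x) * V.character (Equiv.ofBijective _ hbij x)⁻¹
      = (Module.finrank ℂ V : ℂ) ^ 2 * ((if q ∣ (x.1 : ℕ) then (1 : ℂ) else 0) * (if q ∣ (x.2 : ℕ) then (1 : ℂ) else 0)) := by
    rintro ⟨i, j⟩
    simp only [Equiv.ofBijective_apply]
    by_cases h : q ∣ (i : ℕ) ∧ q ∣ (j : ℕ)
    · rw [if_pos h.1, if_pos h.2]
      obtain ⟨⟨i', hi⟩, ⟨j', hj⟩⟩ := h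
      have hs : ∃ κ : ℂ, V.ρ (a ^ (i : ℕ) * b ^ (j : ℕ)) = κ • 1 := by
        refine ⟨ζ ^ i' * ω ^ j', ?_⟩
        rw [map_mul, map_pow, map_pow, hi, hj, pow_mul, pow_mul, hAq, hBq]
        simp only [smul_pow, one_pow, mul_smul_comm, mul_one, smul_smul, mul_comm]
      obtain ⟨κ, hκ⟩ := hs
      set g := a ^ (i : ℕ) * b ^ (j : ℕ)
      have h1 : V.ρ g * V.ρ g⁻¹ = 1 := by rw [← map_mul, mul_inv_cancel, map_one]
      rw [hκ, smul_mul_assoc, one_mul] at h1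
      have h2 : V.character g = κ * Module.finrank ℂ V := by
        rw [FDRep.character, hκ, map_smul, LinearMap.trace_one, smul_eq_mul]
      have h3 : κ * V.character g⁻¹ = Module.finrank ℂ V := by
        rw [FDRep.character, ← smul_eq_mul, ← map_smul, h1, LinearMap.trace_one]
      rw [h2, mul_right_comm, h3]; ring
    · have : V.character (a ^ (i : ℕ) * b ^ (j : ℕ)) = 0 := by
        rw [FDRep.character, map_mul, map_pow, map_pow, tr_formula _ _ (hu a) (hu b) q hq ζ ω ε hε hAq hBq hBA, if_neg h]
      rw [this, zero_mul, ite_zero_mul_ite_zero, if_neg h, mul_zero]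
  rw [Finset.sum_congr rfl fun x _ => this x, ← Finset.mul_sum, Fintype.sum_prod_type]
  subst hN hM
  have h5 := Finset.sum_mul_sum Finset.univ Finset.univ
    (fun i : Fin (q * N') => if q ∣ (i : ℕ) then (1 : ℂ) else 0)
    (fun i : Fin (q * M') => if q ∣ (i : ℕ) then (1 : ℂ) else 0)
  rw [sum_dvd _ _ hq, sum_dvd _ _ hq] at h5
  rw [h5]
theorem final_count {G : Type} (F : ℂ → ℂ → G → ℂ) (P : (G → ℂ) → Prop) (N K : ℕ) (hN : 0 < N)
    (hK : 0 < K) (hKN : K ∣ N)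
    (hP : ∀ χ, P χ ↔ ∃ ζ ω, IsPrimitiveRoot ζ N ∧ ω ^ K = 1 ∧ χ = F ζ ω)
    (hinj : ∀ ζ ω ζ' ω', IsPrimitiveRoot ζ N → ω ^ K = 1 → IsPrimitiveRoot ζ' N → ω' ^ K = 1 →
      F ζ ω = F ζ' ω' → ζ = ζ' ∧ ω = ω')
    (hσ : ∀ (σ : ℂ ≃+* ℂ) ζ ω, (fun g => σ (F ζ ω g)) = F (σ ζ) (σ ω)) :
    Nat.card {C : Set (G → ℂ) | ∃ χ : G → ℂ, P χ ∧
      C = {χ' | ∃ σ : ℂ ≃+* ℂ, χ' = fun g => σ (χ g)}} = K ∧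
    ∀ C : Set (G → ℂ), (∃ χ : G → ℂ, P χ ∧
      C = {χ' | ∃ σ : ℂ ≃+* ℂ, χ' = fun g => σ (χ g)}) → C.ncard = Nat.totient N := by
  have : NeZero N := ⟨hN.ne'⟩
  have : NeZero K := ⟨hK.ne'⟩
  have hpow : ∀ ζ ω : ℂ, IsPrimitiveRoot ζ N → ω ^ K = 1 → ∃ c, ω = ζ ^ c := by
    intro ζ ω hζ hω
    obtain ⟨k, hk⟩ := hKN
    obtain ⟨c, _, hc⟩ := hζ.eq_pow_of_pow_eq_one (ξ := ω) (by rw [hk, pow_mul, hω, one_pow])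
    exact ⟨c, hc.symm⟩
  have hprim : ∀ (σ : ℂ ≃+* ℂ) ζ, IsPrimitiveRoot ζ N → IsPrimitiveRoot (σ ζ) N :=
    fun σ ζ h => h.map_of_injective σ.injective
  have hroot : ∀ (σ : ℂ ≃+* ℂ) ω, ω ^ K = 1 → (σ ω) ^ K = 1 := fun σ ω h => by
    rw [← map_pow, h, map_one]
  let cl : (G → ℂ) → Set (G → ℂ) := fun χ => {χ' | ∃ σ : ℂ ≃+* ℂ, χ' = fun g => σ (χ g)}
  have hcl : ∀ (σ : ℂ ≃+* ℂ) χ, cl (fun g => σ (χ g)) = cl χ := by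
    intro σ χ
    ext χ'
    constructor
    · rintro ⟨τ, rfl⟩; exact ⟨σ.trans τ, rfl⟩
    · rintro ⟨τ, rfl⟩; exact ⟨σ.symm.trans τ, by ext g; simp⟩
  constructor
  · obtain ⟨ζ0, hζ0⟩ : ∃ ζ : ℂ, IsPrimitiveRoot ζ N := ⟨_, Complex.isPrimitiveRoot_exp N hN.ne'⟩
    obtain ⟨w0, hw0⟩ : ∃ ζ : ℂ, IsPrimitiveRoot ζ K := ⟨_, Complex.isPrimitiveRoot_exp K hK.ne'⟩
    let f : Fin K → {C : Set (G → ℂ) | ∃ χ : G → ℂ, P χ ∧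
      C = {χ' | ∃ σ : ℂ ≃+* ℂ, χ' = fun g => σ (χ g)}} := fun i =>
      ⟨cl (F ζ0 (w0 ^ (i : ℕ))), F ζ0 (w0 ^ (i : ℕ)), (hP _).2 ⟨_, _, hζ0, by
        rw [← pow_mul, mul_comm, pow_mul, hw0.pow_eq_one, one_pow], rfl⟩, rfl⟩
    have hw : ∀ i : ℕ, (w0 ^ i) ^ K = 1 := fun i => by
      rw [← pow_mul, mul_comm, pow_mul, hw0.pow_eq_one, one_pow]
    have hf : Function.Bijective f := by
      constructor
      · intro i j hij
        have h1 : cl (F ζ0 (w0 ^ (i : ℕ))) = cl (F ζ0 (w0 ^ (j : ℕ))) := congrArg Subtype.val hij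
        have h2 : F ζ0 (w0 ^ (i : ℕ)) ∈ cl (F ζ0 (w0 ^ (j : ℕ))) := by
          rw [← h1]; exact ⟨RingEquiv.refl ℂ, rfl⟩
        obtain ⟨σ, h3⟩ := h2
        rw [hσ] at h3
        obtain ⟨h4, h5⟩ := hinj _ _ _ _ hζ0 (hw i) (hprim σ _ hζ0) (hroot σ _ (hw j)) h3
        obtain ⟨c, hc⟩ := hpow ζ0 _ hζ0 (hw j)
        rw [hc, map_pow, ← h4, ← hc] at h5
        exact Fin.ext (hw0.pow_inj i.2 j.2 h5)
      · rintro ⟨C, χ, hχ, rfl⟩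
        obtain ⟨ζ, ω, hζ, hω, rfl⟩ := (hP χ).1 hχ
        obtain ⟨σ, hs⟩ := galois_ext N ζ ζ0 hζ hζ0
        obtain ⟨i, hi, hi'⟩ := hw0.eq_pow_of_pow_eq_one (hroot σ _ hω)
        refine ⟨⟨i, hi⟩, Subtype.ext ?_⟩
        change cl (F ζ0 (w0 ^ i)) = cl (F ζ ω)
        rw [← hcl σ (F ζ ω), hσ, hs, hi']
    rw [← Nat.card_eq_of_bijective f hf, Nat.card_fin]
  · rintro C ⟨χ, hχ, rfl⟩
    obtain ⟨ζ, ω, hζ, hω, rfl⟩ := (hP χ).1 hχ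
    obtain ⟨c, hc⟩ := hpow ζ ω hζ hω
    have himg : {χ' | ∃ σ : ℂ ≃+* ℂ, χ' = fun g => σ (F ζ ω g)} =
        (fun z => F z (z ^ c)) '' (primitiveRoots N ℂ : Set ℂ) := by
      ext χ'
      constructor
      · rintro ⟨σ, rfl⟩
        refine ⟨σ ζ, by simpa [mem_primitiveRoots hN] using hprim σ ζ hζ, ?_⟩
        rw [hσ, hc, map_pow]
      · rintro ⟨z, hz, rfl⟩
        obtain ⟨σ, hs⟩ := galois_ext N ζ z hζ (by simpa [mem_primitiveRoots hN] using hz)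
        refine ⟨σ, ?_⟩
        rw [hσ, hc, map_pow, hs]
    have hzc : ∀ z, z ∈ (primitiveRoots N ℂ : Set ℂ) → IsPrimitiveRoot z N ∧ (z ^ c) ^ K = 1 := by
      intro z hz
      have hz' : IsPrimitiveRoot z N := by simpa [mem_primitiveRoots hN] using hz
      obtain ⟨σ, hs⟩ := galois_ext N ζ z hζ hz'
      refine ⟨hz', ?_⟩
      rw [← hs, ← map_pow, ← hc]
      exact hroot σ _ hω
    rw [himg, Set.InjOn.ncard_image, Set.ncard_coe_finset, Complex.card_primitiveRoots]
    intro z hz z' hz' h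
    exact (hinj _ _ _ _ (hzc z hz).1 (hzc z hz).2 (hzc z' hz').1 (hzc z' hz').2 h).1

theorem scal_zpow {G R : Type*} [Group G] [Ring R] [Algebra ℂ R] [Nontrivial R] (f : G →* R) (g : G) (κ : ℂ)
    (h : f g = κ • 1) (z : ℤ) : f (g ^ z) = κ ^ z • 1 := by
  have h1 : f g * f g⁻¹ = 1 := by rw [← map_mul, mul_inv_cancel, map_one]
  rw [h, smul_mul_assoc, one_mul] at h1
  have hk : κ ≠ 0 := by rintro rfl; simp at h1
  have h2 : f g⁻¹ = κ⁻¹ • 1 := by rw [← h1, smul_smul, inv_mul_cancel₀ hk, one_smul]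
  rcases Int.eq_nat_or_neg z with ⟨k, rfl | rfl⟩
  · rw [zpow_natCast, zpow_natCast, map_pow, h, smul_pow, one_pow]
  · rw [zpow_neg, zpow_neg, zpow_natCast, zpow_natCast, ← inv_pow, ← inv_pow, map_pow, h2, smul_pow, one_pow]

theorem model (q : ℕ) [NeZero q] (ζ ω ε : ℂ) (hε : IsPrimitiveRoot ε q) :
    ∃ A B : Module.End ℂ (ZMod q → ℂ), A ^ q = ζ • 1 ∧ B ^ q = ω • 1 ∧ B * A = ε • (A * B) := by
  obtain ⟨l, hl⟩ := IsAlgClosed.exists_pow_nat_eq ζ (NeZero.pos q)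
  obtain ⟨β, hβ⟩ := IsAlgClosed.exists_pow_nat_eq ω (NeZero.pos q)
  let ψ := AddChar.zmodChar q hε.pow_eq_one
  let Z : Module.End ℂ (ZMod q → ℂ) :=
    { toFun := fun f x => ψ x * f x
      map_add' := fun f g => by ext x; simp [mul_add]
      map_smul' := fun c f => by ext x; simp [mul_left_comm] }
  let X : Module.End ℂ (ZMod q → ℂ) :=
    { toFun := fun f x => f (x + 1)
      map_add' := fun f g => by ext x; simp
      map_smul' := fun c f => by ext x; simp }
  have hψ1 : ψ 1 = ε := by
    rw [← Nat.cast_one, AddChar.zmodChar_apply', pow_one]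
  have hZ : ∀ k : ℕ, ∀ f x, (Z ^ k) f x = ψ x ^ k * f x := by
    intro k
    induction k with
    | zero => simp
    | succ k ih =>
      intro f x
      rw [pow_succ', Module.End.mul_apply]
      change ψ x * (Z ^ k) f x = _
      rw [ih]; ring
  have hX : ∀ k : ℕ, ∀ f x, (X ^ k) f x = f (x + k) := by
    intro k
    induction k with
    | zero => simp
    | succ k ih =>
      intro f x
      rw [pow_succ', Module.End.mul_apply]
      change (X ^ k) f (x + 1) = _
      rw [ih]; congr 1; push_cast; ring
  refine ⟨l • Z, β • X, ?_, ?_, ?_⟩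
  · rw [smul_pow, hl]
    congr 1
    refine LinearMap.ext fun f => funext fun x => ?_
    rw [hZ, AddChar.zmodChar_apply, ← pow_mul, mul_comm x.val, pow_mul, hε.pow_eq_one]; simp
  · rw [smul_pow, hβ]
    congr 1
    refine LinearMap.ext fun f => funext fun x => ?_
    rw [hX]; simp
  · have : X * Z = ε • (Z * X) := by
      refine LinearMap.ext fun f => funext fun x => ?_
      change ψ (x + 1) * f (x + 1) = ε * (ψ x * f (x + 1))
      rw [AddChar.map_add_eq_mul, hψ1]; ring
    rw [smul_mul_smul_comm, smul_mul_smul_comm, this, smul_smul, smul_smul]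
    congr 1; ring

theorem eps_prim (p k t E : ℕ) (hp : p.Prime) (hk : k = E + t) (c : ℤ) (hc : ¬ (p : ℤ) ∣ c) (ζ : ℂ)
    (hζ : IsPrimitiveRoot ζ (p ^ k)) : IsPrimitiveRoot (ζ ^ ((p : ℤ) ^ E * c)) (p ^ t) := by
  have h1 : IsPrimitiveRoot (ζ ^ (p ^ E)) (p ^ t) := hζ.pow (pow_pos hp.pos _) (by rw [hk, pow_add])
  have h2 := h1.zpow_of_gcd_eq_one c (by
    rw [← Int.isCoprime_iff_gcd_eq_one]
    push_cast
    exact (((Nat.prime_iff_prime_int.1 hp).coprime_iff_not_dvd.2 hc).symm).pow_right)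
  rw [← zpow_natCast, ← zpow_mul] at h2
  push_cast at h2
  exact h2

theorem exists_irrep {G : Type} [Group G] (p n m s t : ℕ) (hp : p.Prime) (r c : ℤ)
    (hr : r = 1 + p ^ (n - s) * c) (hc : ¬ (p : ℤ) ∣ c) (hts : t ≤ s) (hsm : s ≤ m) (hmn : m ≤ n - s)
    (a b : G) (ha : a ^ (p ^ n) = 1) (hb : b ^ (p ^ m) = 1) (hrel : b * a * b⁻¹ = a ^ r)
    (hgen : Subgroup.closure {a, b} = ⊤) (hcard : Nat.card G = p ^ n * p ^ m) (ζ ω : ℂ)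
    (hζ : IsPrimitiveRoot ζ (p ^ (n - s))) (hω : ω ^ (p ^ (m - t)) = 1) :
    ∃ V : FDRep ℂ G, Simple V ∧ Module.finrank ℂ V = p ^ t ∧ V.ρ a ^ (p ^ t) = ζ • 1 ∧
      V.ρ b ^ (p ^ t) = ω • 1 ∧
      V.ρ b * V.ρ a = (ζ ^ ((p : ℤ) ^ (n - s - t) * c)) • (V.ρ a * V.ρ b) := by
  have hq : 0 < p ^ t := pow_pos hp.pos _
  have : NeZero (p ^ t) := ⟨hq.ne'⟩
  have hε := eps_prim p (n - s) t (n - s - t) hp (by omega) c hc ζ hζ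
  set ε := ζ ^ ((p : ℤ) ^ (n - s - t) * c) with hεdef
  obtain ⟨A, B, hA, hB, hBA⟩ := model (p ^ t) ζ ω ε hε
  have hAN : A ^ (p ^ n) = 1 := by
    rw [show p ^ n = p ^ t * (p ^ (n - s) * p ^ (s - t)) by
      rw [← pow_add, ← pow_add]; congr 1; omega, pow_mul, hA, smul_pow, one_pow, pow_mul, hζ.pow_eq_one]
    simp
  have hBM : B ^ (p ^ m) = 1 := by
    rw [show p ^ m = p ^ t * p ^ (m - t) by
      rw [← pow_add]; congr 1; omega, pow_mul, hB, smul_pow, one_pow, hω, one_smul]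
  let A' := Units.ofPowEqOne A (p ^ n) hAN (pow_pos hp.pos _).ne'
  let B' := Units.ofPowEqOne B (p ^ m) hBM (pow_pos hp.pos _).ne'
  have hA' : (A' : Module.End ℂ (ZMod (p ^ t) → ℂ)) = A := rfl
  have hB' : (B' : Module.End ℂ (ZMod (p ^ t) → ℂ)) = B := rfl
  have hrq : r = 1 + ((p ^ t : ℕ) : ℤ) * ((p : ℤ) ^ (n - s - t) * c) := by
    rw [hr, ← mul_assoc]; push_cast; rw [← pow_add]; congr 4; omega
  have hAr : ((A' ^ r : (Module.End ℂ (ZMod (p ^ t) → ℂ))ˣ) : Module.End ℂ (ZMod (p ^ t) → ℂ)) = ε • A := by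
    rw [hrq, zpow_add, zpow_one, zpow_mul, zpow_natCast]
    have := scal_zpow (Units.coeHom (Module.End ℂ (ZMod (p ^ t) → ℂ))) (A' ^ (p ^ t)) ζ (by
      rw [Units.coeHom_apply, Units.val_pow_eq_pow_val, hA', hA]) ((p : ℤ) ^ (n - s - t) * c)
    rw [Units.coeHom_apply] at this
    rw [Units.val_mul, this, hA', mul_smul_comm, mul_one]
  obtain ⟨f, hfa, hfb⟩ := exists_hom a b (p ^ n) (p ^ m) (pow_pos hp.pos _) (pow_pos hp.pos _) r ha hb hrel hgen
    hcard A' B' (Units.ext (by simpa [hA'] using hAN)) (Units.ext (by simpa [hB'] using hBM)) (by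
      rw [mul_inv_eq_iff_eq_mul]
      apply Units.ext
      rw [Units.val_mul, Units.val_mul, hAr, hA', hB', hBA, smul_mul_assoc])
  let ρ : Representation ℂ G (ZMod (p ^ t) → ℂ) := (Units.coeHom _).comp f
  have hρa : (FDRep.of ρ).ρ a = A := by
    change ((f a : (Module.End ℂ (ZMod (p ^ t) → ℂ))ˣ) : Module.End ℂ (ZMod (p ^ t) → ℂ)) = A
    rw [hfa, hA']
  have hρb : (FDRep.of ρ).ρ b = B := by
    change ((f b : (Module.End ℂ (ZMod (p ^ t) → ℂ))ˣ) : Module.End ℂ (ZMod (p ^ t) → ℂ)) = B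
    rw [hfb, hB']
  have hdim : Module.finrank ℂ (FDRep.of ρ) = p ^ t := by
    change Module.finrank ℂ (ZMod (p ^ t) → ℂ) = p ^ t
    rw [Module.finrank_fintype_fun_eq_card, ZMod.card]
  have e1 : (FDRep.of ρ).ρ a ^ (p ^ t) = ζ • 1 := by rw [hρa]; exact hA
  have e2 : (FDRep.of ρ).ρ b ^ (p ^ t) = ω • 1 := by rw [hρb]; exact hB
  have e3 : (FDRep.of ρ).ρ b * (FDRep.of ρ).ρ a = ε • ((FDRep.of ρ).ρ a * (FDRep.of ρ).ρ b) := by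
    rw [hρa, hρb]; exact hBA
  refine ⟨FDRep.of ρ, ?_, hdim, e1, e2, e3⟩
  have : Finite G := Nat.finite_of_card_ne_zero (by rw [hcard]; exact (mul_pos (pow_pos hp.pos _) (pow_pos hp.pos _)).ne')
  have := Fintype.ofFinite G
  rw [FDRep.simple_iff_char_is_norm_one]
  rw [norm_sum a b (p ^ n) (p ^ m) (p ^ t) (p ^ (n - t)) (p ^ (m - t)) hq
    (by rw [← pow_add]; congr 1; omega) (by rw [← pow_add]; congr 1; omega)
    (nf_bij a b _ _ (pow_pos hp.pos _) (pow_pos hp.pos _) r ha hb hrel hgen hcard) (FDRep.of ρ) ζ ω ε hε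
    e1 e2 e3, hdim, hcard]
  norm_cast
  rw [← pow_mul, ← pow_add, ← pow_add, ← pow_add]
  congr 1; omega

theorem irrep_struct {G : Type} [Group G] (p n m s t : ℕ) (hp : p.Prime) (r c : ℤ)
    (hr : r = 1 + p ^ (n - s) * c) (hc : ¬ (p : ℤ) ∣ c) (ht : 1 ≤ t) (hts : t ≤ s) (hsm : s ≤ m) (hmn : m ≤ n - s)
    (a b : G) (ha : a ^ (p ^ n) = 1) (hb : b ^ (p ^ m) = 1) (hrel : b * a * b⁻¹ = a ^ r)
    (hgen : Subgroup.closure {a, b} = ⊤) (hcard : Nat.card G = p ^ n * p ^ m)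
    (V : FDRep ℂ G) (hV : Simple V) (hdim : Module.finrank ℂ V = p ^ t) :
    ∃ ζ ω : ℂ, IsPrimitiveRoot ζ (p ^ (n - s)) ∧ ω ^ (p ^ (m - t)) = 1 ∧ V.ρ a ^ (p ^ t) = ζ • 1 ∧
      V.ρ b ^ (p ^ t) = ω • 1 ∧
      V.ρ b * V.ρ a = (ζ ^ ((p : ℤ) ^ (n - s - t) * c)) • (V.ρ a * V.ρ b) := by
  have hbij := nf_bij a b _ _ (pow_pos hp.pos _) (pow_pos hp.pos _) r ha hb hrel hgen hcard
  have : Finite G := Nat.finite_of_card_ne_zero (by rw [hcard]; exact (mul_pos (pow_pos hp.pos _) (pow_pos hp.pos _)).ne')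
  have := Fintype.ofFinite G
  have : Nontrivial V := Module.nontrivial_of_finrank_pos (R := ℂ) (by rw [hdim]; exact pow_pos hp.pos _)
  have hsc : ∀ x y : ℂ, x • (1 : Module.End ℂ V) = y • 1 → x = y := by
    intro x y h
    exact smul_left_injective ℂ (one_ne_zero (α := Module.End ℂ V)) h
  have hschur : ∀ f : Module.End ℂ V, Commute f (V.ρ a) → Commute f (V.ρ b) → ∃ k : ℂ, f = k • 1 := by
    intro f h1 h2
    refine schur V f fun g => ?_
    obtain ⟨⟨i, j⟩, rfl⟩ := hbij.2 g
    simp only [map_mul, map_pow]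
    exact (h1.pow_right i).mul_right (h2.pow_right j)
  set x : G := a ^ ((p : ℤ) ^ (n - s) * c) with hx
  have hz : ∀ z : ℤ, ((p : ℤ) ^ n ∣ z) → a ^ z = 1 := by
    rintro z ⟨k, rfl⟩
    rw [zpow_mul, show ((p : ℤ) ^ n) = ((p ^ n : ℕ) : ℤ) by push_cast; rfl, zpow_natCast, ha, one_zpow]
  have hbx : b * x * b⁻¹ = x := by
    rw [hx, ← conj_zpow, hrel, ← zpow_mul, hr, add_mul, one_mul, zpow_add]
    rw [hz ((p : ℤ) ^ (n - s) * c * (p ^ (n - s) * c)), mul_one]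
    rw [show (p : ℤ) ^ (n - s) * c * (p ^ (n - s) * c) = p ^ n * (p ^ (n - s - s) * c * c) by
      have h6 : (p : ℤ) ^ (n - s) * p ^ (n - s) = p ^ n * p ^ (n - s - s) := by
        rw [← pow_add, ← pow_add]; congr 1; omega
      linear_combination c * c * h6]
    exact dvd_mul_right _ _
  have hba : b * a = x * (a * b) := by
    rw [← mul_assoc, ← mul_inv_eq_iff_eq_mul, hrel, hr, zpow_add, zpow_one, hx]
    rw [← zpow_one_add, add_comm, zpow_add_one]
  obtain ⟨ε, hε⟩ := hschur (V.ρ x) (by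
      rw [Commute, SemiconjBy, ← map_mul, ← map_mul, hx]
      congr 1
      exact ((Commute.refl a).zpow_left _).eq) (by
      rw [Commute, SemiconjBy, ← map_mul, ← map_mul]
      congr 1
      rw [mul_inv_eq_iff_eq_mul] at hbx
      exact hbx.symm)
  have hBA : V.ρ b * V.ρ a = ε • (V.ρ a * V.ρ b) := by
    rw [← map_mul, hba, map_mul, hε, smul_mul_assoc, one_mul, map_mul]
  have hεs : ε ^ (p ^ s) = 1 := by
    apply hsc
    rw [one_smul]
    have : V.ρ (x ^ (p ^ s)) = ε ^ (p ^ s) • 1 := by rw [map_pow, hε, smul_pow, one_pow]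
    rw [← this, hx, ← zpow_natCast, ← zpow_mul, hz, map_one]
    push_cast
    rw [mul_right_comm, ← pow_add, Nat.sub_add_cancel (by omega)]
    exact dvd_mul_right _ _
  obtain ⟨u, hu, hou⟩ := (Nat.dvd_prime_pow hp).1 (orderOf_dvd_of_pow_eq_one hεs)
  have hεp : IsPrimitiveRoot ε (p ^ u) := hou ▸ IsPrimitiveRoot.orderOf ε
  obtain ⟨ζ, hζ⟩ := hschur (V.ρ a ^ (p ^ u)) ((Commute.refl _).pow_left _) (by
    have := q_comm_pow _ _ ε hBA (p ^ u)
    rw [hεp.pow_eq_one, one_smul] at this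
    exact this.symm)
  obtain ⟨ω, hω⟩ := hschur (V.ρ b ^ (p ^ u)) (by
    have := q_comm_pow' _ _ ε hBA (p ^ u)
    rw [hεp.pow_eq_one, one_smul] at this
    exact this) ((Commute.refl _).pow_left _)
  have hut : u = t := by
    have h1 := (FDRep.simple_iff_char_is_norm_one V).1 hV
    rw [norm_sum a b (p ^ n) (p ^ m) (p ^ u) (p ^ (n - u)) (p ^ (m - u)) (pow_pos hp.pos _)
      (by rw [← pow_add]; congr 1; omega) (by rw [← pow_add]; congr 1; omega)
      hbij V ζ ω ε hεp hζ hω hBA, hdim, hcard] at h1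
    norm_cast at h1
    rw [← pow_mul, ← pow_add, ← pow_add, ← pow_add] at h1
    have := Nat.pow_right_injective hp.two_le h1
    omega
  subst hut
  have hζn : ζ ^ (p ^ (n - u)) = 1 := by
    apply hsc
    rw [← one_pow (p ^ (n - u)), ← smul_pow, ← hζ, ← pow_mul, ← pow_add, one_pow, one_smul,
      ← map_pow, show u + (n - u) = n by omega, ha, map_one]
  have hεζ : ζ ^ ((p : ℤ) ^ (n - s - u) * c) = ε := by
    apply hsc
    rw [← hε, ← scal_zpow V.ρ (a ^ (p ^ u)) ζ (by rw [map_pow, hζ]), hx, ← zpow_natCast, ← zpow_mul]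
    congr 2
    push_cast
    rw [← mul_assoc, ← pow_add]
    congr 2
    omega
  refine ⟨ζ, ω, ?_, ?_, hζ, hω, ?_⟩
  · have hy : (ζ ^ (p ^ (n - s))) ^ c = 1 := by
      have := hεp.pow_eq_one
      rw [← hεζ, ← zpow_natCast, ← zpow_mul] at this
      rw [← this, ← zpow_natCast, ← zpow_mul]
      congr 1
      push_cast
      rw [mul_right_comm, ← pow_add]
      congr 2
      omega
    have hy1 : ζ ^ (p ^ (n - s)) = 1 := by
      have h1 : (ζ ^ (p ^ (n - s))) ^ (p ^ (s - u)) = 1 := by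
        rw [← pow_mul, ← pow_add, show n - s + (s - u) = n - u by omega, hζn]
      obtain ⟨k, hk, hok⟩ := (Nat.dvd_prime_pow hp).1 (orderOf_dvd_of_pow_eq_one h1)
      rcases Nat.eq_zero_or_pos k with rfl | hk0
      · rw [pow_zero, orderOf_eq_one_iff] at hok; exact hok
      · exfalso
        have h2 := ((IsPrimitiveRoot.orderOf (ζ ^ (p ^ (n - s)))).zpow_eq_one_iff_dvd c).1 hy
        rw [hok] at h2
        push_cast at h2
        exact hc ((dvd_pow_self _ hk0.ne').trans h2)
    have hy2 : ¬ ζ ^ (p ^ (n - s - 1)) = 1 := by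
      intro h
      have h3 : ε ^ (p ^ (u - 1)) = 1 := by
        rw [← hεζ, ← zpow_natCast, ← zpow_mul]
        rw [← one_zpow c, ← h, ← zpow_natCast, ← zpow_mul]
        congr 1
        push_cast
        rw [mul_right_comm, ← pow_add]
        congr 2
        omega
      have := Nat.le_of_dvd (pow_pos hp.pos _) (hεp.dvd_of_pow_eq_one _ h3)
      have := (Nat.pow_le_pow_iff_right hp.one_lt).1 this
      omega
    have : Fact p.Prime := ⟨hp⟩
    have h4 := orderOf_eq_prime_pow hy2 (by rwa [Nat.sub_add_cancel (by omega)])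
    rw [Nat.sub_add_cancel (by omega)] at h4
    exact h4 ▸ IsPrimitiveRoot.orderOf ζ
  · apply hsc
    rw [← one_pow (p ^ (m - u)), ← smul_pow, ← hω, ← pow_mul, ← pow_add, one_pow, one_smul,
      ← map_pow, show u + (m - u) = m by omega, hb, map_one]
  · rw [hεζ]; exact hBA

/-- **Remark (Galois classes of nonlinear characters, case `n-s ≥ m`).**
Let `p` be an odd prime and let
`G = ⟨a, b | a^(p^n) = b^(p^m) = 1, b a b⁻¹ = a^r⟩` be the split metacyclic
`p`-group, with `n ≥ 2`, `m ≥ 1`, `gcd(r, p^n) = 1`, `r` of multiplicative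
order `p^s` modulo `p^n` and `1 ≤ s ≤ min {n-1, m}`.  Suppose `n - s ≥ m`.
Then for each `1 ≤ t ≤ s`, there are exactly `p^(m-t)` Galois conjugacy classes
(over `ℚ`) of irreducible complex characters of `G` of degree `p^t`, and each
such class has cardinality `φ(p^(n-s))`. -/
theorem stmt_19 (p n m s : ℕ) (r : ℤ) (hp : p.Prime) (hodd : Odd p)
    (hn : 2 ≤ n) (hm : 1 ≤ m) (hs1 : 1 ≤ s) (hsn : s ≤ n - 1) (hsm : s ≤ m)
    (hr : Int.gcd r (p ^ n) = 1) (hord : orderOf ((r : ZMod (p ^ n))) = p ^ s)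
    (G : Type) [Group G] (a b : G)
    (hcard : Nat.card G = p ^ (n + m))
    (ha : orderOf a = p ^ n) (hb : orderOf b = p ^ m)
    (hrel : b * a * b⁻¹ = a ^ r)
    (hgen : Subgroup.closure {a, b} = ⊤)
    (hcase : m ≤ n - s) :
    ∀ t : ℕ, 1 ≤ t → t ≤ s →
      Nat.card {C : Set (G → ℂ) |
          ∃ χ : G → ℂ,
            (∃ V : FDRep ℂ G, Simple V ∧ FDRep.character V = χ ∧
                Module.finrank ℂ V = p ^ t) ∧
            C = {χ' | ∃ σ : ℂ ≃+* ℂ, χ' = fun g => σ (χ g)}}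
        = p ^ (m - t) ∧
      ∀ C : Set (G → ℂ),
        (∃ χ : G → ℂ,
            (∃ V : FDRep ℂ G, Simple V ∧ FDRep.character V = χ ∧
                Module.finrank ℂ V = p ^ t) ∧
            C = {χ' | ∃ σ : ℂ ≃+* ℂ, χ' = fun g => σ (χ g)}) →
        C.ncard = Nat.totient (p ^ (n - s)) := by
  intro t ht hts
  have hN : 0 < p ^ n := pow_pos hp.pos _
  have hM : 0 < p ^ m := pow_pos hp.pos _
  have hq : 0 < p ^ t := pow_pos hp.pos _
  have hqC : ((p ^ t : ℕ) : ℂ) ≠ 0 := by exact_mod_cast hq.ne'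
  have ha1 : a ^ (p ^ n) = 1 := by rw [← ha]; exact pow_orderOf_eq_one a
  have hb1 : b ^ (p ^ m) = 1 := by rw [← hb]; exact pow_orderOf_eq_one b
  have hcard1 : Nat.card G = p ^ n * p ^ m := by rw [hcard, pow_add]
  obtain ⟨c, hrc, hc⟩ := lte_r p n s r hp hodd hs1 hsn hord
  have hbij := nf_bij a b _ _ hN hM r ha1 hb1 hrel hgen hcard1
  let e := Equiv.ofBijective _ hbij
  let F : ℂ → ℂ → G → ℂ := fun ζ ω g =>
    if p ^ t ∣ ((e.symm g).1 : ℕ) ∧ p ^ t ∣ ((e.symm g).2 : ℕ) then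
      ((p ^ t : ℕ) : ℂ) * (ζ ^ (((e.symm g).1 : ℕ) / p ^ t) * ω ^ (((e.symm g).2 : ℕ) / p ^ t)) else 0
  have htr : ∀ (V : FDRep ℂ G) (ζ ω : ℂ), IsPrimitiveRoot ζ (p ^ (n - s)) →
      Module.finrank ℂ V = p ^ t → V.ρ a ^ (p ^ t) = ζ • 1 → V.ρ b ^ (p ^ t) = ω • 1 →
      V.ρ b * V.ρ a = (ζ ^ ((p : ℤ) ^ (n - s - t) * c)) • (V.ρ a * V.ρ b) →
      V.character = F ζ ω := by
    intro V ζ ω hζ hd h1 h2 h3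
    have hε := eps_prim p (n - s) t (n - s - t) hp (by omega) c hc ζ hζ
    ext g
    have hg : g = a ^ ((e.symm g).1 : ℕ) * b ^ ((e.symm g).2 : ℕ) := (e.apply_symm_apply g).symm
    have h4 := tr_formula (V.ρ a) (V.ρ b) ((Group.isUnit a).map V.ρ) ((Group.isUnit b).map V.ρ)
      (p ^ t) hq ζ ω _ hε h1 h2 h3 (e.symm g).1 (e.symm g).2
    rw [← map_pow, ← map_pow, ← map_mul, ← hg, hd] at h4
    exact h4
  have hval : ∀ ζ ω : ℂ, IsPrimitiveRoot ζ (p ^ (n - s)) → ω ^ (p ^ (m - t)) = 1 →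
      F ζ ω (a ^ (p ^ t)) = ζ * (p ^ t : ℕ) ∧ F ζ ω (b ^ (p ^ t)) = ω * (p ^ t : ℕ) := by
    intro ζ ω hζ hω
    obtain ⟨V, _, hd, h1, h2, h3⟩ := exists_irrep p n m s t hp r c hrc hc hts hsm hcase a b ha1 hb1 hrel
      hgen hcard1 ζ ω hζ hω
    rw [← htr V ζ ω hζ hd h1 h2 h3]
    constructor
    · rw [FDRep.character, map_pow, h1, map_smul, LinearMap.trace_one, smul_eq_mul, hd]
    · rw [FDRep.character, map_pow, h2, map_smul, LinearMap.trace_one, smul_eq_mul, hd]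
  refine final_count F (fun χ => ∃ V : FDRep ℂ G, Simple V ∧ FDRep.character V = χ ∧
    Module.finrank ℂ V = p ^ t) (p ^ (n - s)) (p ^ (m - t)) (pow_pos hp.pos _) (pow_pos hp.pos _)
    (pow_dvd_pow _ (by omega)) ?_ ?_ ?_
  · intro χ
    constructor
    · rintro ⟨V, hV, rfl, hd⟩
      obtain ⟨ζ, ω, hζ, hω, h1, h2, h3⟩ := irrep_struct p n m s t hp r c hrc hc ht hts hsm hcase a b
        ha1 hb1 hrel hgen hcard1 V hV hd
      exact ⟨ζ, ω, hζ, hω, htr V ζ ω hζ hd h1 h2 h3⟩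
    · rintro ⟨ζ, ω, hζ, hω, rfl⟩
      obtain ⟨V, hV, hd, h1, h2, h3⟩ := exists_irrep p n m s t hp r c hrc hc hts hsm hcase a b ha1 hb1
        hrel hgen hcard1 ζ ω hζ hω
      exact ⟨V, hV, htr V ζ ω hζ hd h1 h2 h3, hd⟩
  · intro ζ ω ζ' ω' hζ hω hζ' hω' h
    obtain ⟨h1, h2⟩ := hval ζ ω hζ hω
    obtain ⟨h3, h4⟩ := hval ζ' ω' hζ' hω'
    rw [← h] at h3 h4
    exact ⟨mul_right_cancel₀ hqC (h1.symm.trans h3), mul_right_cancel₀ hqC (h2.symm.trans h4)⟩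
  · intro σ ζ ω
    ext g
    simp only [F]
    split_ifs
    · rw [map_mul, map_mul, map_pow, map_pow, map_natCast]
    · exact map_zero σ
end
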